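/- arXiv:1306.0828 — 2 statements merged into one kernel-verified Lean document; each statement's English description precedes it below -/
import Mathlib

section
/- Let R be a Noetherian commutative ring and k ∈ ℕ, with R[X] and its Sym(ℕ)- and Inc(ℕ)-actions as in the context. Let Y, R[Y] and the induced Inc(ℕ)-action on Y be as in the context, and let φ : R[Y] → R[X] be a Sym(ℕ)-equivariant R-algebra homomorphism that sends every variable y ∈ Y to a monomial (a finite product of the variables x_{i,j}). Then there exist finitely many binomials f₁,…,f_r ∈ ker φ (each of the form u − v for monomials u, v in the variables Y) such that ker φ is generated as an ideal of R[Y] by the union of the Inc(ℕ)-orbits of f₁,…,f_r. -/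
open MvPolynomial

theorem exists_perm_forall_pos_of_mem_doublyStochastic {n : Type*} [Fintype n] [DecidableEq n]
    {M : Matrix n n ℝ} (hM : M ∈ doublyStochastic ℝ n) : ∃ σ : Equiv.Perm n, ∀ i, 0 < M i (σ i) := by
  obtain ⟨w, hw0, hw1, rfl⟩ := exists_eq_sum_perm_of_mem_doublyStochastic hM
  obtain ⟨σ, -, hσ⟩ : ∃ σ ∈ Finset.univ, 0 < w σ :=
    Finset.exists_lt_of_sum_lt (f := fun _ => (0 : ℝ)) (by simp [hw1])
  refine ⟨σ, fun i => ?_⟩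
  rw [Matrix.sum_apply]
  refine Finset.sum_pos' (fun τ _ => ?_) ⟨σ, Finset.mem_univ _, ?_⟩
  · simp only [Matrix.smul_apply, smul_eq_mul, Equiv.Perm.permMatrix, Equiv.toPEquiv_apply,
      PEquiv.toMatrix_apply]
    exact mul_nonneg (hw0 τ) (ite_nonneg zero_le_one le_rfl)
  · simpa [Equiv.Perm.permMatrix, PEquiv.toMatrix_apply] using hσ

/-- In a bipartite multigraph with left degrees equal to `d` and right degrees at most `d`, some
matching covers all left vertices and all right vertices of degree `d`. -/
theorem exists_transversal {K d : ℕ} (hd : 0 < d) (A : Fin K → Multiset ℕ)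
    (hrow : ∀ l, (A l).card = d) (hcol : ∀ j, ∑ l, (A l).count j ≤ d) :
    ∃ J : Fin K ↪ ℕ, (∀ l, J l ∈ A l) ∧ ∀ j, ∑ l, (A l).count j = d → ∃ l, J l = j := by
  obtain ⟨t, ht⟩ : ∃ t, ∀ l, ∀ j ∈ A l, j < t := by
    refine ⟨∑ l, (A l).sum + 1, fun l j hj => Nat.lt_succ_of_le ?_⟩
    exact (Multiset.le_sum_of_mem hj).trans
      (Finset.single_le_sum (f := fun l => (A l).sum) (fun _ _ => Nat.zero_le _)
        (Finset.mem_univ l))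
  let T := t + 1
  let e : Fin K ⊕ Fin T ≃ Fin (K + T) := finSumFinEquiv
  let c : ℕ → ℕ := fun j => ∑ l, (A l).count j
  have hd' : (0 : ℝ) < d := by exact_mod_cast hd
  have hT : (0 : ℝ) < T := by positivity
  have hsum : ∀ l, ∑ j, (A l).count (e j : ℕ) = d := by
    intro l
    rw [e.sum_comp (fun j : Fin (K + T) => (A l).count (j : ℕ)),
      Fin.sum_univ_eq_sum_range (fun j => (A l).count j), ← hrow l]
    refine Multiset.sum_count_eq_card fun j hj => ?_
    have := ht l j hj
    simp only [Finset.mem_range, T]; omega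
  let M : Matrix (Fin K ⊕ Fin T) (Fin K ⊕ Fin T) ℝ := fun i j =>
    Sum.elim (fun l => ((A l).count (e j : ℕ) : ℝ) / d) (fun _ => (1 - (c (e j) : ℝ) / d) / T) i
  have hM : M ∈ doublyStochastic ℝ _ := by
    rw [mem_doublyStochastic_iff_sum]
    refine ⟨?_, ?_, ?_⟩
    · rintro (l | l) j
      · simp only [M, Sum.elim_inl]; positivity
      · simp only [M, Sum.elim_inr]
        refine div_nonneg (sub_nonneg.2 ?_) hT.le
        rw [div_le_one hd']
        exact_mod_cast hcol _
    · rintro (l | l)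
      · simp only [M, Sum.elim_inl]
        rw [← Finset.sum_div, ← Nat.cast_sum, hsum, div_self hd'.ne']
      · simp only [M, Sum.elim_inr]
        rw [← Finset.sum_div, Finset.sum_sub_distrib, ← Finset.sum_div, ← Nat.cast_sum]
        have : ∑ j, c (e j) = K * d := by
          simp only [c]
          rw [Finset.sum_comm]
          simp [hsum]
        rw [this]
        simp only [Finset.sum_const, Finset.card_univ, Fintype.card_sum, Fintype.card_fin]
        push_cast
        field_simp
        simp
    · intro j
      simp only [Fintype.sum_sum_type, M, Sum.elim_inl, Sum.elim_inr]
      rw [← Finset.sum_div]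
      simp only [Finset.sum_const, Finset.card_univ, Fintype.card_fin, nsmul_eq_mul, c]
      push_cast
      field_simp
      ring
  obtain ⟨σ, hσ⟩ := exists_perm_forall_pos_of_mem_doublyStochastic hM
  refine ⟨⟨fun l => e (σ (Sum.inl l)), fun l l' h => ?_⟩, fun l => ?_, fun j hj => ?_⟩
  · simpa [Fin.val_inj] using h
  · have h := hσ (Sum.inl l)
    by_contra hn
    have : (A l).count (e (σ (Sum.inl l)) : ℕ) = 0 := Multiset.count_eq_zero.2 hn
    simp [M, this] at h
  · have hjt : j < K + T := by
      obtain ⟨l, -, hl⟩ := Finset.exists_ne_zero_of_sum_ne_zero (by rw [hj]; exact hd.ne')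
      have := ht l j (Multiset.count_ne_zero.1 hl)
      simp only [T]; omega
    obtain ⟨i, hi⟩ := (σ.trans e).surjective ⟨j, hjt⟩
    have hij : (e (σ i) : ℕ) = j := by simpa using congrArg Fin.val hi
    rcases i with l | l
    · exact ⟨l, hij⟩
    · have h := hσ (Sum.inr l)
      simp only [M, Sum.elim_inr, hij, c, hj, div_self hd'.ne', sub_self, zero_div,
        lt_irrefl] at h

/-- The family of columns of a table, given as the multiset of its rows. -/
def tableColumns (K : ℕ) : Multiset (Fin K ↪ ℕ) →+ (Fin K → Multiset ℕ) where
  toFun u l := u.map fun J => J l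
  map_zero' := rfl
  map_add' u v := by ext1 l; simp

theorem tableColumns_apply {K : ℕ} (u : Multiset (Fin K ↪ ℕ)) (l : Fin K) :
    tableColumns K u l = u.map fun J => J l := rfl

theorem tableColumns_cons {K : ℕ} (J : Fin K ↪ ℕ) (u : Multiset (Fin K ↪ ℕ)) (l : Fin K) :
    tableColumns K (J ::ₘ u) l = J l ::ₘ tableColumns K u l := by
  simp [tableColumns_apply]

theorem card_tableColumns {K : ℕ} (u : Multiset (Fin K ↪ ℕ)) (l : Fin K) :
    (tableColumns K u l).card = u.card := by
  simp [tableColumns_apply]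

open Classical in
theorem sum_count_tableColumns {K : ℕ} (u : Multiset (Fin K ↪ ℕ)) (j : ℕ) :
    ∑ l, (tableColumns K u l).count j = u.countP fun J : Fin K ↪ ℕ => j ∈ Set.range J := by
  induction u using Multiset.induction_on with
  | empty => simp
  | cons J u ih =>
    simp only [tableColumns_cons, Multiset.count_cons, Finset.sum_add_distrib, ih,
      Multiset.countP_cons]
    congr 1
    split_ifs with h
    · obtain ⟨l, rfl⟩ := h
      simp [J.injective.eq_iff]
    · refine Finset.sum_eq_zero fun l _ => if_neg ?_
      rintro rfl
      exact h ⟨l, rfl⟩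

theorem sum_count_tableColumns_le {K : ℕ} (u : Multiset (Fin K ↪ ℕ)) (j : ℕ) :
    ∑ l, (tableColumns K u l).count j ≤ u.card := by
  classical
  rw [sum_count_tableColumns]
  exact Multiset.countP_le_card _ _

/-- **König's edge colouring theorem** in terms of tables with injective rows. -/
theorem exists_tableColumns_eq {K d : ℕ} (A : Fin K → Multiset ℕ)
    (hrow : ∀ l, (A l).card = d) (hcol : ∀ j, ∑ l, (A l).count j ≤ d) :
    ∃ u : Multiset (Fin K ↪ ℕ), u.card = d ∧ tableColumns K u = A := by
  induction d generalizing A with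
  | zero =>
    refine ⟨0, rfl, ?_⟩
    ext1 l
    rw [map_zero, Pi.zero_apply, Multiset.card_eq_zero.1 (hrow l)]
  | succ d ih =>
    obtain ⟨J, hJ, hJd⟩ := exists_transversal d.succ_pos A hrow hcol
    have key : ∀ j, ∑ l, ((A l).erase (J l)).count j + (if j ∈ Set.range J then 1 else 0)
        = ∑ l, (A l).count j := by
      classical
      intro j
      have : (if j ∈ Set.range J then 1 else 0) = ∑ l, if j = J l then 1 else 0 := by
        have := sum_count_tableColumns {J} j
        simp only [tableColumns_apply, Multiset.map_singleton, Multiset.count_singleton] at this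
        rw [this, ← Multiset.cons_zero, Multiset.countP_cons]
        simp
      rw [this, ← Finset.sum_add_distrib]
      refine Finset.sum_congr rfl fun l _ => ?_
      rw [← Multiset.count_cons, Multiset.cons_erase (hJ l)]
    obtain ⟨u, hu, huA⟩ := ih (fun l => (A l).erase (J l))
      (fun l => by rw [Multiset.card_erase_of_mem (hJ l), hrow l]; rfl) (fun j => by
        have h1 := key j
        have h2 := hcol j
        split_ifs at h1 with h
        · omega
        · have : ∑ l, (A l).count j ≠ d + 1 := fun hj => h (hJd j hj)
          omega)
    refine ⟨J ::ₘ u, by simp [hu], ?_⟩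
    ext1 l
    rw [tableColumns_cons, huA, Multiset.cons_erase (hJ l)]

/-- If the transversal `r` of the columns of the table `u` can be completed to a table with the
same columns as `u`, then this is possible by changing at most `2 * K` rows of `u`. -/
theorem exists_le_tableColumns_cons_eq {K : ℕ} (hK : 0 < K) (r : Fin K ↪ ℕ)
    (u v : Multiset (Fin K ↪ ℕ)) (h : tableColumns K u = tableColumns K (r ::ₘ v)) :
    ∃ s ≤ u, s.card ≤ 2 * K ∧ ∃ w, tableColumns K s = tableColumns K (r ::ₘ w) := by
  classical
  have hr : ∀ l, ∃ J ∈ u, J l = r l := fun l => by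
    have : r l ∈ tableColumns K u l := by
      rw [h, tableColumns_cons]; exact Multiset.mem_cons_self _ _
    simpa [tableColumns_apply] using this
  choose J hJu hJr using hr
  have hcard : u.card = v.card + 1 := by
    rw [← card_tableColumns u ⟨0, hK⟩, h, card_tableColumns, Multiset.card_cons]
  have hmiss : ∀ j, ∃ J' ∈ u, j ∉ Set.range r → j ∉ Set.range J' := by
    intro j
    by_cases hj : j ∈ Set.range r
    · exact ⟨J ⟨0, hK⟩, hJu _, fun h => absurd hj h⟩
    · by_contra! hall
      have h1 := sum_count_tableColumns u j
      rw [h, sum_count_tableColumns, Multiset.countP_cons, if_neg hj,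
        Multiset.countP_eq_card.2 fun J' hJ' => (hall J' hJ').2] at h1
      have := Multiset.countP_le_card (fun J : Fin K ↪ ℕ => j ∈ Set.range J) v
      omega
  choose J' hJ'u hJ'r using hmiss
  let s : Finset (Fin K ↪ ℕ) :=
    Finset.univ.image J ∪ Finset.univ.image fun l => J' (J ⟨0, hK⟩ l)
  have hJs : ∀ l, J l ∈ s.val := fun l => by simp [s]
  have hJ's : ∀ l, J' (J ⟨0, hK⟩ l) ∈ s.val := fun l => by simp [s]
  refine ⟨s.val, ?_, ?_, ?_⟩
  · rw [Multiset.le_iff_subset s.nodup]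
    intro x hx
    rw [Finset.mem_val] at hx
    simp only [s, Finset.mem_union, Finset.mem_image, Finset.mem_univ, true_and] at hx
    rcases hx with ⟨l, rfl⟩ | ⟨l, rfl⟩
    · exact hJu l
    · exact hJ'u _
  · refine (Finset.card_union_le _ _).trans ?_
    have h1 := Finset.card_image_le (s := Finset.univ) (f := J)
    have h2 := Finset.card_image_le (s := Finset.univ) (f := fun l => J' (J ⟨0, hK⟩ l))
    simp only [Finset.card_univ, Fintype.card_fin] at h1 h2
    omega
  · have hmem : ∀ l, r l ∈ tableColumns K s.val l := fun l => by
      rw [tableColumns_apply, ← hJr l]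
      exact Multiset.mem_map_of_mem _ (hJs l)
    have hpos : 0 < s.val.card := Multiset.card_pos_iff_exists_mem.2 ⟨_, hJs ⟨0, hK⟩⟩
    have hcol : ∀ j, ∑ l, ((tableColumns K s.val l).erase (r l)).count j ≤ s.val.card - 1 := by
      intro j
      by_cases hj : j ∈ Set.range r
      · obtain ⟨l, rfl⟩ := hj
        refine Nat.le_sub_one_of_lt (lt_of_lt_of_le ?_ (sum_count_tableColumns_le s.val (r l)))
        refine Finset.sum_lt_sum (fun l' _ => Multiset.count_le_of_le _ (Multiset.erase_le _ _))
          ⟨l, Finset.mem_univ _, ?_⟩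
        rw [Multiset.count_erase_self]
        exact Nat.sub_lt (Multiset.count_pos.2 (hmem l)) one_pos
      · refine (Finset.sum_le_sum fun l' _ =>
          Multiset.count_le_of_le _ (Multiset.erase_le _ _)).trans ?_
        rw [sum_count_tableColumns]
        refine Nat.le_sub_one_of_lt (lt_of_le_of_ne (Multiset.countP_le_card _ _) fun heq => ?_)
        rw [Multiset.countP_eq_card] at heq
        obtain ⟨l, hl⟩ := heq _ (hJs ⟨0, hK⟩)
        exact hJ'r j hj (hl ▸ heq _ (hJ's l))
    obtain ⟨w, -, hw⟩ := exists_tableColumns_eq (d := s.val.card - 1)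
      (fun l => (tableColumns K s.val l).erase (r l))
      (fun l => by rw [Multiset.card_erase_of_mem (hmem l), card_tableColumns]; rfl) hcol
    refine ⟨w, ?_⟩
    ext1 l
    rw [tableColumns_cons, hw, Multiset.cons_erase (hmem l)]

/-- Tables with injective rows and the same columns are connected by moves changing at most
`2 * K` rows at a time. -/
theorem addCon_of_tableColumns_eq {K : ℕ} (hK : 0 < K) (c : AddCon (Multiset (Fin K ↪ ℕ)))
    (hc : ∀ u v, tableColumns K u = tableColumns K v → u.card ≤ 2 * K → c u v)
    (u v : Multiset (Fin K ↪ ℕ)) (h : tableColumns K u = tableColumns K v) : c u v := by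
  induction v using Multiset.induction_on generalizing u with
  | empty =>
    refine hc u 0 h ?_
    rw [← card_tableColumns u ⟨0, hK⟩, h]
    simp
  | cons r v ih =>
    obtain ⟨s, hs, hsK, w, hw⟩ := exists_le_tableColumns_cons_eq hK r u v h
    obtain ⟨t, rfl⟩ := Multiset.le_iff_exists_add.1 hs
    have h1 : c (s + t) (r ::ₘ w + t) := c.add (hc _ _ hw hsK) (c.refl t)
    refine c.trans h1 ?_
    rw [Multiset.cons_add, ← Multiset.singleton_add, ← Multiset.singleton_add]
    refine c.add (c.refl _) (ih _ ?_)
    rw [map_add, hw, ← Multiset.singleton_add, ← Multiset.singleton_add, map_add, map_add,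
      add_assoc] at h
    rw [map_add]
    exact add_left_cancel h

theorem Ultrafilter.exists_eventually_eq_of_eventually_lt {α : Type*} (U : Ultrafilter α)
    {d : α → ℕ} {c : ℕ} (h : ∀ᶠ n in U, d n < c) : ∃ a, ∀ᶠ n in U, d n = a := by
  have h' : ⋃ a ∈ Set.Iio c, {n | d n = a} ∈ U := by
    filter_upwards [h] with n hn
    simpa using hn
  obtain ⟨a, -, ha⟩ := (Ultrafilter.finite_biUnion_mem_iff (Set.finite_Iio c)).1 h'
  exact ⟨a, ha⟩

theorem Ultrafilter.exists_eventually_eq_or_eventually_le {α : Type*} (U : Ultrafilter α)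
    (d : α → ℕ) : (∃ a, ∀ᶠ n in U, d n = a) ∨ ∀ c, ∀ᶠ n in U, c ≤ d n := by
  refine or_iff_not_imp_right.2 fun h => ?_
  obtain ⟨c, hc⟩ := not_forall.1 h
  refine U.exists_eventually_eq_of_eventually_lt (c := c) ?_
  simpa using Ultrafilter.eventually_not.2 hc

open Classical in
/-- A sequence of finite families `col n p` of natural numbers with sums `O(d n p)` has a
subsequence along which the increments of `d` exceed a threshold `e`, in such a way that the
number of entries above the threshold is constant. -/
theorem exists_subseq_thresholds {P : Type*} [Finite P] (K : ℕ) (d : ℕ → P → ℕ)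
    (col : ℕ → P → ℕ → ℕ) (s b : ℕ → ℕ)
    (hsum : ∀ n p, ∑ j ∈ Finset.range (s n), col n p j ≤ K * d n p) :
    ∃ (f : ℕ → ℕ) (e : ℕ → P → ℕ) (N : ℕ),
      (∀ i, {j ∈ Finset.range (s (f i)) | ∃ p, e (f i) p < col (f i) p j}.card = N) ∧
      ∀ i i', i < i' → b (f i) ≤ f i' ∧ ∀ p, d (f i) p + e (f i') p ≤ d (f i') p := by
  have := Fintype.ofFinite P
  let U : Ultrafilter ℕ := Filter.hyperfilter ℕ
  have hU : ∀ c, ∀ᶠ n in (U : Filter ℕ), c ≤ n := fun c =>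
    Nat.hyperfilter_le_atTop (Filter.eventually_ge_atTop c)
  have hdich := fun p => U.exists_eventually_eq_or_eventually_le fun n => d n p
  let Q : P → Prop := fun p => ∃ a, ∀ᶠ n in U, d n p = a
  have hQ : ∀ p, ∃ a, Q p → ∀ᶠ n in U, d n p = a := fun p => by
    by_cases h : Q p
    · exact ⟨_, fun _ => h.choose_spec⟩
    · exact ⟨0, fun h' => absurd h' h⟩
  choose a ha using hQ
  let e : ℕ → P → ℕ := fun n p => if Q p then 0 else d n p / 2
  let big : ℕ → Finset ℕ := fun n => {j ∈ Finset.range (s n) | ∃ p, e n p < col n p j}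
  have hbig : ∀ n, (∀ p, Q p → d n p = a p) → (big n).card < ∑ p, (K * a p + 2 * K) + 1 := by
    intro n hn
    have hsub : big n ⊆ Finset.univ.biUnion fun p =>
        {j ∈ Finset.range (s n) | e n p < col n p j} := by
      intro j hj
      simp only [big, Finset.mem_filter] at hj
      obtain ⟨hj, p, hp⟩ := hj
      exact Finset.mem_biUnion.2 ⟨p, Finset.mem_univ _, Finset.mem_filter.2 ⟨hj, hp⟩⟩
    refine Nat.lt_succ_of_le ((Finset.card_le_card hsub).trans
      (Finset.card_biUnion_le.trans (Finset.sum_le_sum fun p _ => ?_)))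
    set t := {j ∈ Finset.range (s n) | e n p < col n p j}
    have h1 : t.card * (e n p + 1) ≤ K * d n p := by
      rw [← smul_eq_mul]
      refine (Finset.card_nsmul_le_sum t (col n p) _ fun j hj => ?_).trans
        ((Finset.sum_le_sum_of_subset (Finset.filter_subset _ _)).trans (hsum n p))
      exact (Finset.mem_filter.1 hj).2
    by_cases hp : Q p
    · simp only [e, if_pos hp, zero_add, mul_one, hn p hp] at h1
      omega
    · simp only [e, if_neg hp] at h1
      have h2 : K * d n p ≤ 2 * K * (d n p / 2 + 1) := by
        rw [mul_comm 2 K, mul_assoc]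
        exact Nat.mul_le_mul_left _ (by omega)
      have := Nat.le_of_mul_le_mul_right (h1.trans h2) (Nat.succ_pos _)
      omega
  have haU : ∀ᶠ n in U, ∀ p, Q p → d n p = a p :=
    Filter.eventually_all.2 fun p => by
      by_cases hp : Q p
      · filter_upwards [ha p hp] with n hn _ using hn
      · exact Filter.Eventually.of_forall fun n h => absurd h hp
  obtain ⟨N, hN⟩ := U.exists_eventually_eq_of_eventually_lt (haU.mono hbig)
  obtain ⟨f, hf, hr⟩ := exists_seq_of_forall_finset_exists
    (fun n => (∀ p, Q p → d n p = a p) ∧ (big n).card = N)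
    (fun m n => b m ≤ n ∧ ∀ p, ¬ Q p → 2 * d m p ≤ d n p) (fun t _ => by
      refine Filter.Eventually.exists (f := (U : Filter ℕ))
        ((haU.and hN).and ((Filter.eventually_all_finset t).2 fun m _ =>
          (hU _).and (Filter.eventually_all.2 fun p => ?_)))
      by_cases hp : Q p
      · exact Filter.Eventually.of_forall fun n h => absurd hp h
      · filter_upwards [(hdich p).resolve_left hp (2 * d m p)] with n hn _ using hn)
  refine ⟨f, e, N, fun i => ?_, fun i i' hi => ⟨(hr i i' hi).1, fun p => ?_⟩⟩
  · convert (hf i).2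
  · by_cases hp : Q p
    · simp only [e, if_pos hp, (hf i).1 p hp, (hf i').1 p hp, add_zero, le_refl]
    · have := (hr i i' hi).2 p hp
      simp only [e, if_neg hp]
      omega

theorem exists_orderEmbedding_of_sublistForall₂ {α : Type*} {R : α → α → Prop} {s₁ s₂ : ℕ}
    {f₁ f₂ : ℕ → α}
    (h : List.SublistForall₂ R ((List.range s₁).map f₁) ((List.range s₂).map f₂)) :
    ∃ π : ℕ ↪o ℕ, ∀ i < s₁, π i < s₂ ∧ R (f₁ i) (f₂ (π i)) := by
  obtain ⟨l, hl, hsub⟩ := List.sublistForall₂_iff.1 h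
  obtain ⟨π, hπ⟩ := List.sublist_iff_exists_orderEmbedding_getElem?_eq.1 hsub
  have hlen : s₁ = l.length := by simpa using hl.length_eq
  refine ⟨π, fun i hi => ?_⟩
  have h1 := hπ i
  rw [List.getElem?_eq_getElem (hlen ▸ hi)] at h1
  obtain ⟨h2, h3⟩ := List.getElem?_eq_some_iff.1 h1.symm
  have h4 : π i < s₂ := by simpa using h2
  refine ⟨h4, ?_⟩
  have h5 := List.Forall₂.get hl (by simpa using hi) (hlen ▸ hi)
  simp only [List.get_eq_getElem, ← h3] at h5
  simpa using h5

theorem exists_lt_sublistForall₂ {α : Type*} [Preorder α] [WellQuasiOrderedLE α]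
    (w : ℕ → List α) : ∃ i i', i < i' ∧ List.SublistForall₂ (· ≤ ·) (w i) (w i') := by
  have h := Set.PartiallyWellOrderedOn.partiallyWellOrderedOn_sublistForall₂ (· ≤ ·)
    (Set.partiallyWellOrderedOn_univ_iff.2 (wellQuasiOrdered_le (α := α)))
  exact h fun n => ⟨w n, fun x _ => Set.mem_univ x⟩

/-- The families of columns of tables are well-quasi-ordered by divisibility up to strictly
increasing maps. -/
theorem exists_orderEmbedding_divides {P : Type*} [Finite P] (K : ℕ) (d : ℕ → P → ℕ)
    (A : ℕ → P → Fin K → Multiset ℕ) (hrow : ∀ n p l, (A n p l).card = d n p)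
    (hcol : ∀ n p j, ∑ l, (A n p l).count j ≤ d n p) (b : ℕ → ℕ) :
    ∃ m n, b m ≤ n ∧ ∃ π : ℕ ↪o ℕ, ∀ p, d m p ≤ d n p ∧ (∀ l, (A m p l).map π ≤ A n p l) ∧
      ∀ j, ∑ l, (A n p l - (A m p l).map π).count j ≤ d n p - d m p := by
  classical
  have := Fintype.ofFinite P
  have hs : ∀ n, ∃ s, ∀ p l, ∀ j ∈ A n p l, j < s := fun n => by
    refine ⟨∑ p, ∑ l, (A n p l).sum + 1, fun p l j hj => Nat.lt_succ_of_le ?_⟩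
    exact (Multiset.le_sum_of_mem hj).trans
      ((Finset.single_le_sum (f := fun l => (A n p l).sum) (fun _ _ => Nat.zero_le _)
        (Finset.mem_univ l)).trans
      (Finset.single_le_sum (f := fun p => ∑ l, (A n p l).sum) (fun _ _ => Nat.zero_le _)
        (Finset.mem_univ p)))
  choose s hs using hs
  have hs0 : ∀ n p l j, s n ≤ j → (A n p l).count j = 0 := fun n p l j hj =>
    Multiset.count_eq_zero.2 fun h => (hs n p l j h).not_ge hj
  let col : ℕ → P → ℕ → ℕ := fun n p j => ∑ l, (A n p l).count j
  have hsum : ∀ n p, ∑ j ∈ Finset.range (s n), col n p j ≤ K * d n p := fun n p => by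
    rw [Finset.sum_comm]
    refine le_of_eq ?_
    rw [Finset.sum_congr rfl fun l _ =>
      (Multiset.sum_count_eq_card fun j hj => Finset.mem_range.2 (hs n p l j hj)).trans
        (hrow n p l)]
    simp
  obtain ⟨f, e, N, hN, hf⟩ := exists_subseq_thresholds K d col s b hsum
  let big : ℕ → ℕ → Prop := fun n j => ∃ p, e n p < col n p j
  let letter : ℕ → ℕ → (P → Fin K → ℕ) × (P → ℕ) × ℕ × ℕ := fun n j =>
    (fun p l => (A n p l).count j, fun p => d n p - col n p j,
      if big n j then 1 else 0, if big n j then 0 else 1)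
  obtain ⟨i, i', hii, hw⟩ := exists_lt_sublistForall₂ fun i =>
    (List.range (s (f i))).map (letter (f i))
  obtain ⟨π, hπ⟩ := exists_orderEmbedding_of_sublistForall₂ hw
  obtain ⟨hb, hd⟩ := hf i i' hii
  have hNi : {j ∈ Finset.range (s (f i)) | big (f i) j}.card = N := by convert hN i
  have hNi' : {j ∈ Finset.range (s (f i')) | big (f i') j}.card = N := by convert hN i'
  set m := f i
  set n := f i'
  have hcount : ∀ p l j, (A m p l).count j ≤ (A n p l).count (π j) := fun p l j => by
    rcases lt_or_ge j (s m) with hj | hj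
    · exact (hπ j hj).2.1 p l
    · simp [hs0 m p l j hj]
  have hbig : ∀ j < s n, big n j → ∃ i < s m, π i = j := by
    have himg : ({j ∈ Finset.range (s m) | big m j}).image π =
        {j ∈ Finset.range (s n) | big n j} := by
      refine Finset.eq_of_subset_of_card_le (fun j hj => ?_) ?_
      · obtain ⟨j, hj', rfl⟩ := Finset.mem_image.1 hj
        obtain ⟨hjm, hjb⟩ := Finset.mem_filter.1 hj'
        obtain ⟨h1, -, -, h2, -⟩ := hπ j (Finset.mem_range.1 hjm)
        refine Finset.mem_filter.2 ⟨Finset.mem_range.2 h1, ?_⟩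
        by_contra hn
        simp [letter, hjb, hn] at h2
      · rw [Finset.card_image_of_injective _ π.injective]
        exact (hNi'.trans hNi.symm).le
    intro j hj hjb
    have : j ∈ ({j ∈ Finset.range (s m) | big m j}).image π := by
      rw [himg]
      exact Finset.mem_filter.2 ⟨Finset.mem_range.2 hj, hjb⟩
    obtain ⟨i, hi, rfl⟩ := Finset.mem_image.1 this
    exact ⟨i, Finset.mem_range.1 (Finset.mem_filter.1 hi).1, rfl⟩
  refine ⟨m, n, hb, π, fun p => ⟨by have := hd p; omega, fun l => ?_, fun j => ?_⟩⟩
  · refine Multiset.le_iff_count.2 fun j => ?_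
    by_cases hj : j ∈ Set.range π
    · obtain ⟨j, rfl⟩ := hj
      rw [Multiset.count_map_eq_count' π _ π.injective]
      exact hcount p l j
    · rw [Multiset.count_eq_zero.2]
      · exact Nat.zero_le _
      · intro h
        obtain ⟨x, -, hx⟩ := Multiset.mem_map.1 h
        exact hj ⟨x, hx⟩
  · simp only [Multiset.count_sub]
    by_cases hj : ∃ i < s m, π i = j
    · obtain ⟨j, hjm, rfl⟩ := hj
      simp only [Multiset.count_map_eq_count' π _ π.injective]
      rw [Finset.sum_tsub_distrib _ fun l _ => hcount p l j]
      have h1 : d m p - col m p j ≤ d n p - col n p (π j) := (hπ j hjm).2.2.1 p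
      have h2 := hcol m p j
      have h3 := hcol n p (π j)
      have h4 := hd p
      simp only [col] at h1
      omega
    · have h1 : col n p j ≤ e n p := by
        rcases lt_or_ge j (s n) with hjs | hjs
        · by_contra hlt
          exact hj (hbig j hjs ⟨p, not_le.1 hlt⟩)
        · simp [col, hs0 n p _ j hjs]
      have h2 := hd p
      calc _ ≤ col n p j := Finset.sum_le_sum fun l _ => Nat.sub_le _ _
        _ ≤ _ := by omega

/-- Applying a strictly increasing map to all entries of a family of tables. -/
def shiftTables {I : Type*} {K : ℕ} (π : ℕ ↪o ℕ) (u : I → Multiset (Fin K ↪ ℕ)) :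
    I → Multiset (Fin K ↪ ℕ) :=
  fun p => (u p).map fun J => J.trans π.toEmbedding

theorem tableColumns_shiftTables {I : Type*} {K : ℕ} (π : ℕ ↪o ℕ)
    (u : I → Multiset (Fin K ↪ ℕ)) (p : I) :
    tableColumns K (shiftTables π u p) = fun l => (tableColumns K (u p) l).map π := by
  ext1 l
  simp [tableColumns_apply, shiftTables]

/-- The column family of a family of tables. -/
def familyColumns (I : Type*) (K : ℕ) :
    (I → Multiset (Fin K ↪ ℕ)) →+ (I → Fin K → Multiset ℕ) :=
  AddMonoidHom.compLeft (tableColumns K) I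

theorem familyColumns_apply {I : Type*} {K : ℕ} (u : I → Multiset (Fin K ↪ ℕ)) (p : I) :
    familyColumns I K u p = tableColumns K (u p) := rfl

theorem familyColumns_shiftTables {I : Type*} {K : ℕ} (π : ℕ ↪o ℕ)
    (u : I → Multiset (Fin K ↪ ℕ)) :
    familyColumns I K (shiftTables π u) = fun p l => (familyColumns I K u p l).map π :=
  funext fun p => tableColumns_shiftTables π u p

theorem addCon_of_familyColumns_eq {I : Type*} [Finite I] {K : ℕ} (hK : 0 < K)
    (c : AddCon (I → Multiset (Fin K ↪ ℕ)))
    (hc : ∀ u v, familyColumns I K u = familyColumns I K v → (∀ p, (u p).card ≤ 2 * K) →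
      (∀ p, (v p).card ≤ 2 * K) → c u v)
    (u v : I → Multiset (Fin K ↪ ℕ)) (h : familyColumns I K u = familyColumns I K v) :
    c u v := by
  classical
  have := Fintype.ofFinite I
  have key : ∀ p, c (Pi.single p (u p)) (Pi.single p (v p)) := fun p => by
    refine addCon_of_tableColumns_eq hK
      (AddCon.comap (AddMonoidHom.single (fun _ : I => Multiset (Fin K ↪ ℕ)) p)
        (map_add _) c) (fun s t hst hs => ?_) (u p) (v p) (congrFun h p)
    have ht : t.card ≤ 2 * K := by
      rw [← card_tableColumns t ⟨0, hK⟩, ← hst, card_tableColumns]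
      exact hs
    refine hc _ _ (funext fun q => ?_) (fun q => ?_) fun q => ?_
    · by_cases hq : q = p
      · subst hq
        simpa [familyColumns_apply] using hst
      · simp [familyColumns_apply, hq]
    · by_cases hq : q = p
      · subst hq
        simpa using hs
      · simp [hq]
    · by_cases hq : q = p
      · subst hq
        simpa using ht
      · simp [hq]
  rw [← Finset.univ_sum_single u, ← Finset.univ_sum_single v]
  exact c.finsetSum _ fun p _ => key p

/-- Division of families of tables, given the corresponding division of their columns. -/
theorem exists_familyColumns_eq_add {I : Type*} {K : ℕ} (π : ℕ ↪o ℕ)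
    (u u' : I → Multiset (Fin K ↪ ℕ))
    (h : ∀ p, (u p).card ≤ (u' p).card ∧
      (∀ l, (tableColumns K (u p) l).map π ≤ tableColumns K (u' p) l) ∧
      ∀ j, ∑ l, (tableColumns K (u' p) l - (tableColumns K (u p) l).map π).count j
        ≤ (u' p).card - (u p).card) :
    ∃ w, familyColumns I K u' = familyColumns I K (shiftTables π u + w) ∧
      ∀ p, (u' p).card = (u p).card + (w p).card := by
  have hw : ∀ p, ∃ w : Multiset (Fin K ↪ ℕ), w.card = (u' p).card - (u p).card ∧
      tableColumns K w = fun l => tableColumns K (u' p) l - (tableColumns K (u p) l).map π :=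
    fun p => exists_tableColumns_eq _ (fun l => by
      rw [Multiset.card_sub ((h p).2.1 l), Multiset.card_map, card_tableColumns,
        card_tableColumns]) (h p).2.2
  choose w hwcard hw using hw
  refine ⟨w, ?_, fun p => by have := (h p).1; have := hwcard p; omega⟩
  rw [map_add, familyColumns_shiftTables]
  ext1 p
  ext1 l
  rw [Pi.add_apply, Pi.add_apply, familyColumns_apply, familyColumns_apply, familyColumns_apply,
    hw p]
  exact (add_tsub_cancel_of_le ((h p).2.1 l)).symm

/-- An equivariant congruence on families of tables that is the kernel of a homomorphism factoring
through the column families is generated by its pairs of bounded size. -/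
theorem exists_bound_addCon {I M : Type*} [Finite I] [AddCommMonoid M] [IsCancelAdd M]
    {K : ℕ} (hK : 0 < K) (Ψ : (I → Fin K → Multiset ℕ) →+ M)
    (hΨ : ∀ (π : ℕ ↪o ℕ) (A B : I → Fin K → Multiset ℕ), Ψ A = Ψ B →
      Ψ (fun p l => (A p l).map π) = Ψ (fun p l => (B p l).map π)) :
    ∃ n, ∀ c : AddCon (I → Multiset (Fin K ↪ ℕ)),
      (∀ u v, Ψ (familyColumns I K u) = Ψ (familyColumns I K v) → (∀ p, (u p).card ≤ n) →
        (∀ p, (v p).card ≤ n) → c u v) →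
      ∀ u v, Ψ (familyColumns I K u) = Ψ (familyColumns I K v) → c u v := by
  have := Fintype.ofFinite I
  by_contra! hcon
  choose c hc hex using hcon
  let T := I → Multiset (Fin K ↪ ℕ)
  let size : T × T → ℕ := fun x => ∑ p, (x.1 p).card + ∑ p, (x.2 p).card
  have hmin : ∀ n, ∃ x : T × T, (Ψ (familyColumns I K x.1) = Ψ (familyColumns I K x.2) ∧
      ¬ c n x.1 x.2) ∧ ∀ y : T × T, Ψ (familyColumns I K y.1) = Ψ (familyColumns I K y.2) →
      size y < size x → c n y.1 y.2 := fun n => by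
    obtain ⟨u, v, huv⟩ := hex n
    obtain ⟨x, hx, hmin⟩ := (measure size).wf.has_min
      {x : T × T | Ψ (familyColumns I K x.1) = Ψ (familyColumns I K x.2) ∧ ¬ c n x.1 x.2}
      ⟨(u, v), huv⟩
    refine ⟨x, hx, fun y hy hlt => ?_⟩
    by_contra hn
    exact hmin y ⟨hy, hn⟩ hlt
  choose x hx hmin using hmin
  obtain ⟨m, n, hb, π, hdiv⟩ := exists_orderEmbedding_divides (P := I ⊕ I) K
    (fun n => Sum.elim (fun p => ((x n).1 p).card) fun p => ((x n).2 p).card)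
    (fun n => Sum.elim (fun p => tableColumns K ((x n).1 p)) fun p => tableColumns K ((x n).2 p))
    (by rintro n (p | p) l <;> exact card_tableColumns _ _)
    (by rintro n (p | p) j <;> exact sum_count_tableColumns_le _ _)
    (fun n => 2 * K + size (x n))
  obtain ⟨w, hw, hwc⟩ := exists_familyColumns_eq_add π (x m).1 (x n).1 fun p => hdiv (Sum.inl p)
  obtain ⟨w', hw', hwc'⟩ := exists_familyColumns_eq_add π (x m).2 (x n).2 fun p => hdiv (Sum.inr p)
  have hconn := addCon_of_familyColumns_eq hK (c n) fun u v huv hu hv =>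
    hc n u v (congrArg Ψ huv) (fun p => (hu p).trans (by omega)) fun p => (hv p).trans (by omega)
  have hshift : Ψ (familyColumns I K (shiftTables π (x m).1)) =
      Ψ (familyColumns I K (shiftTables π (x m).2)) := by
    rw [familyColumns_shiftTables, familyColumns_shiftTables]
    exact hΨ π _ _ (hx m).1
  have hcshift : c n (shiftTables π (x m).1) (shiftTables π (x m).2) := by
    refine hc n _ _ hshift (fun p => ?_) fun p => ?_
    · have := Finset.single_le_sum (f := fun p => ((x m).1 p).card) (fun _ _ => Nat.zero_le _)
        (Finset.mem_univ p)
      simp only [shiftTables, Multiset.card_map]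
      simp only [size] at hb
      omega
    · have := Finset.single_le_sum (f := fun p => ((x m).2 p).card) (fun _ _ => Nat.zero_le _)
        (Finset.mem_univ p)
      simp only [shiftTables, Multiset.card_map]
      simp only [size] at hb
      omega
  have hww : Ψ (familyColumns I K w) = Ψ (familyColumns I K w') := by
    have h := (hx n).1
    rw [hw, hw', map_add, map_add, map_add, map_add, hshift] at h
    exact add_left_cancel h
  have hcw : ¬ c n w w' := fun h => (hx n).2 <|
    (c n).trans (hconn _ _ hw) <| (c n).trans ((c n).add hcshift h) <| (c n).symm (hconn _ _ hw')
  have hsize : size (x n) = size (x m) + size (w, w') := by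
    simp only [size, hwc, hwc', Finset.sum_add_distrib]
    omega
  have hzero : size (x m) = 0 := by
    by_contra h0
    exact hcw (hmin n (w, w') hww (by omega))
  refine (hx m).2 ?_
  have h0 : (x m).1 = (x m).2 := by
    simp only [size, Nat.add_eq_zero_iff, Finset.sum_eq_zero_iff, Finset.mem_univ, true_imp_iff,
      Multiset.card_eq_zero] at hzero
    ext1 p
    rw [hzero.1 p, hzero.2 p]
  rw [h0]
  exact (c m).refl _

theorem exists_orderEmbedding_image_range (S : Finset ℕ) :
    ∃ π : ℕ ↪o ℕ, ∀ x ∈ S, ∃ i < S.card, π i = x := by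
  let q : ℕ → Prop := fun x => x ∈ S ∨ S.sup id < x
  classical
  have hq : {x | q x}.Infinite :=
    (Set.Ioi_infinite (S.sup id)).mono fun x hx => Or.inr hx
  refine ⟨OrderEmbedding.ofStrictMono (Nat.nth q) (Nat.nth_strictMono hq), fun x hx =>
    ⟨Nat.count q x, ?_, Nat.nth_count (Or.inl hx)⟩⟩
  rw [Nat.count_eq_card_filter_range]
  refine Finset.card_lt_card ((Finset.ssubset_iff_of_subset fun y hy => ?_).2 ⟨x, hx, by simp⟩)
  obtain ⟨hyx, hy⟩ := Finset.mem_filter.1 hy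
  refine hy.resolve_right fun h => ?_
  have : x ≤ S.sup id := Finset.le_sup (f := id) hx
  have := Finset.mem_range.1 hyx
  omega

theorem Multiset.exists_map_eq_of_forall_exists {α β : Type*} {f : α → β} {q : α → Prop}
    {s : Multiset β} (h : ∀ y ∈ s, ∃ x, q x ∧ f x = y) :
    ∃ t : Multiset α, (∀ x ∈ t, q x) ∧ t.map f = s := by
  induction s using Multiset.induction_on with
  | empty => exact ⟨0, by simp, rfl⟩
  | cons y s ih =>
    obtain ⟨t, ht, rfl⟩ := ih fun z hz => h z (Multiset.mem_cons_of_mem hz)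
    obtain ⟨x, hx, rfl⟩ := h y (Multiset.mem_cons_self _ _)
    exact ⟨x ::ₘ t, by simpa [hx] using ht, by simp⟩

theorem finite_setOf_card_le_and_forall_lt (I : Type*) [Finite I] (K n N : ℕ) :
    {u : I → Multiset (Fin K ↪ ℕ) | ∀ p, (u p).card ≤ n ∧ ∀ J ∈ u p, ∀ l, J l < N}.Finite := by
  classical
  have hF : {J : Fin K ↪ ℕ | ∀ l, J l < N}.Finite :=
    Set.Finite.of_finite_image (f := fun J : Fin K ↪ ℕ => (J : Fin K → ℕ))
      ((Set.Finite.pi' fun _ => Set.finite_Iio N).subset (by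
        rintro _ ⟨J, hJ, rfl⟩
        exact hJ)) DFunLike.coe_injective.injOn
  refine Set.Finite.pi' (t := fun _ : I => {s : Multiset (Fin K ↪ ℕ) |
    s.card ≤ n ∧ ∀ J ∈ s, ∀ l, J l < N}) fun _ =>
    (Set.finite_Iic (n • hF.toFinset.val)).subset fun s hs => ?_
  refine Multiset.le_iff_count.2 fun J => ?_
  by_cases hJ : J ∈ s
  · rw [Multiset.count_nsmul, Multiset.count_eq_one_of_mem hF.toFinset.nodup
      (by simpa using hs.2 J hJ), mul_one]
    exact (Multiset.count_le_card _ _).trans hs.1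
  · rw [Multiset.count_eq_zero.2 hJ]
    exact Nat.zero_le _

theorem exists_shiftTables_eq {I : Type*} [Fintype I] {K n : ℕ}
    (u v : I → Multiset (Fin K ↪ ℕ)) (hu : ∀ p, (u p).card ≤ n) (hv : ∀ p, (v p).card ≤ n) :
    ∃ (π : ℕ ↪o ℕ) (u₀ v₀ : I → Multiset (Fin K ↪ ℕ)), shiftTables π u₀ = u ∧
      shiftTables π v₀ = v ∧
      (∀ p, (u₀ p).card ≤ n ∧ ∀ J ∈ u₀ p, ∀ l, J l < Fintype.card I * (2 * n * K)) ∧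
      ∀ p, (v₀ p).card ≤ n ∧ ∀ J ∈ v₀ p, ∀ l, J l < Fintype.card I * (2 * n * K) := by
  classical
  let S : Finset ℕ := Finset.univ.biUnion fun p => (u p + v p).toFinset.biUnion fun J =>
    Finset.univ.image J
  have hS : S.card ≤ Fintype.card I * (2 * n * K) := by
    refine Finset.card_biUnion_le_card_mul _ _ _ fun p _ => ?_
    refine (Finset.card_biUnion_le_card_mul _ _ K fun J _ => ?_).trans
      (Nat.mul_le_mul_right _ ?_)
    · exact Finset.card_image_le.trans (by simp)
    · refine (Multiset.toFinset_card_le _).trans ?_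
      rw [Multiset.card_add]
      have := hu p
      have := hv p
      omega
  obtain ⟨π, hπ⟩ := exists_orderEmbedding_image_range S
  have key : ∀ w : I → Multiset (Fin K ↪ ℕ), (∀ p, w p ≤ u p + v p) → (∀ p, (w p).card ≤ n) →
      ∃ w₀, shiftTables π w₀ = w ∧
        ∀ p, (w₀ p).card ≤ n ∧ ∀ J ∈ w₀ p, ∀ l, J l < Fintype.card I * (2 * n * K) := by
    intro w hw hwn
    have : ∀ p, ∃ t : Multiset (Fin K ↪ ℕ),
        (∀ J ∈ t, ∀ l, J l < Fintype.card I * (2 * n * K)) ∧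
        (t.map fun J => J.trans π.toEmbedding) = w p := fun p => by
      refine Multiset.exists_map_eq_of_forall_exists fun J hJ => ?_
      have hJS : ∀ l, ∃ i < S.card, π i = J l := fun l => hπ _ <|
        Finset.mem_biUnion.2 ⟨p, Finset.mem_univ _, Finset.mem_biUnion.2
          ⟨J, Multiset.mem_toFinset.2 (Multiset.mem_of_le (hw p) hJ),
            Finset.mem_image_of_mem _ (Finset.mem_univ l)⟩⟩
      choose i hi hiJ using hJS
      refine ⟨⟨i, fun l l' hll => J.injective ?_⟩, fun l => (hi l).trans_le hS, ?_⟩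
      · rw [← hiJ, ← hiJ, hll]
      · ext l
        exact hiJ l
    choose w₀ hw₀ hw₀' using this
    refine ⟨w₀, funext hw₀', fun p => ⟨?_, hw₀ p⟩⟩
    rw [← Multiset.card_map (fun J => J.trans π.toEmbedding), hw₀' p]
    exact hwn p
  obtain ⟨u₀, hu₀, hu₀'⟩ := key u (fun p => Multiset.le_add_right _ _) hu
  obtain ⟨v₀, hv₀, hv₀'⟩ := key v (fun p => Multiset.le_add_left _ _) hv
  exact ⟨π, u₀, v₀, hu₀, hv₀, hu₀', hv₀'⟩

/-- An equivariant congruence on families of tables that is the kernel of a homomorphism factoring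
through the column families is generated by finitely many orbits of pairs. -/
theorem exists_finite_generators_addCon {I M : Type*} [Finite I] [AddCommMonoid M] [IsCancelAdd M]
    {K : ℕ} (hK : 0 < K) (Ψ : (I → Fin K → Multiset ℕ) →+ M)
    (hΨ : ∀ (π : ℕ ↪o ℕ) (A B : I → Fin K → Multiset ℕ),
      Ψ (fun p l => (A p l).map π) = Ψ (fun p l => (B p l).map π) ↔ Ψ A = Ψ B) :
    ∃ B : Set ((I → Multiset (Fin K ↪ ℕ)) × (I → Multiset (Fin K ↪ ℕ))), B.Finite ∧
      (∀ x ∈ B, Ψ (familyColumns I K x.1) = Ψ (familyColumns I K x.2)) ∧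
      ∀ c : AddCon (I → Multiset (Fin K ↪ ℕ)),
        (∀ x ∈ B, ∀ π : ℕ ↪o ℕ, c (shiftTables π x.1) (shiftTables π x.2)) →
        ∀ u v, Ψ (familyColumns I K u) = Ψ (familyColumns I K v) → c u v := by
  have := Fintype.ofFinite I
  obtain ⟨n, hn⟩ := exists_bound_addCon hK Ψ fun π A B => (hΨ π A B).2
  have hfin := finite_setOf_card_le_and_forall_lt I K n (Fintype.card I * (2 * n * K))
  refine ⟨_, (hfin.prod hfin).inter_of_left
    {x | Ψ (familyColumns I K x.1) = Ψ (familyColumns I K x.2)}, fun x hx => hx.2,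
    fun c hc => hn c fun u v huv hu hv => ?_⟩
  obtain ⟨π, u₀, v₀, rfl, rfl, hu₀, hv₀⟩ := exists_shiftTables_eq u v hu hv
  refine hc (u₀, v₀) ⟨⟨hu₀, hv₀⟩, ?_⟩ π
  rw [familyColumns_shiftTables, familyColumns_shiftTables] at huv
  exact (hΨ π _ _).1 huv

/-- The kernel of a homomorphism mapping monomials to monomials is contained in each ideal that
contains all its binomials. -/
theorem ker_le_of_binomials_mem {σ τ R : Type*} [CommRing R]
    (φ : MvPolynomial σ R →ₐ[R] MvPolynomial τ R)
    (hφ : ∀ u, ∃ w, φ (monomial u 1) = monomial w 1) (J : Ideal (MvPolynomial σ R))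
    (hJ : ∀ u v : σ →₀ ℕ, φ (monomial u 1) = φ (monomial v 1) →
      monomial u 1 - monomial v 1 ∈ J) :
    RingHom.ker φ ≤ J := by
  choose e he using hφ
  have hρ : ∀ w, ∃ u, w ∈ Set.range e → e u = w := fun w => by
    by_cases h : w ∈ Set.range e
    · exact ⟨h.choose, fun _ => h.choose_spec⟩
    · exact ⟨0, fun h' => absurd h' h⟩
  choose ρ hρ using hρ
  let L : MvPolynomial τ R →ₗ[R] MvPolynomial σ R :=
    (basisMonomials τ R).constr R fun w => monomial (ρ w) 1
  have hL : ∀ w, L (monomial w 1) = monomial (ρ w) 1 := fun w => by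
    have h := (basisMonomials τ R).constr_basis R
      (fun w => (monomial (ρ w) 1 : MvPolynomial σ R)) w
    rwa [coe_basisMonomials] at h
  have key : ∀ f, f - L (φ f) ∈ J := fun f => by
    induction f using MvPolynomial.induction_on' with
    | monomial u a =>
      have h : (monomial u a : MvPolynomial σ R) = a • monomial u 1 := by
        rw [smul_monomial, smul_eq_mul, mul_one]
      rw [h, map_smul, map_smul, he, hL, ← smul_sub]
      refine Submodule.smul_of_tower_mem J a (hJ _ _ ?_)
      rw [he, he, hρ _ ⟨u, rfl⟩]
    | add p q hp hq =>
      rw [map_add, map_add, add_sub_add_comm]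
      exact J.add_mem hp hq
  intro f hf
  have h := key f
  rwa [(RingHom.mem_ker).1 hf, map_zero, sub_zero] at h

/-- The congruence on exponents given by the binomials in an ideal. -/
def idealAddCon {σ R M : Type*} [CommRing R] [AddCommMonoid M] (J : Ideal (MvPolynomial σ R))
    (f : M →+ (σ →₀ ℕ)) : AddCon M where
  r u v := monomial (f u) 1 - monomial (f v) 1 ∈ J
  iseqv :=
    { refl := fun u => by simp
      symm := fun {u v} h => by simpa using J.neg_mem h
      trans := fun {u v w} h h' => by simpa using J.add_mem h h' }
  add' := fun {u v u' v'} h h' => by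
    have h1 := J.add_mem (J.mul_mem_right (monomial (f u') 1) h)
      (J.mul_mem_left (monomial (f v) 1) h')
    simpa [sub_mul, mul_sub, monomial_mul, ← map_add] using h1

/-- The additive homomorphism from families of tables to monomials in variables indexed by rows. -/
noncomputable def tableMonomial {I Y : Type*} [Fintype I] {K : ℕ} (η : I → (Fin K ↪ ℕ) → Y) :
    (I → Multiset (Fin K ↪ ℕ)) →+ (Y →₀ ℕ) where
  toFun u := ∑ p, ((u p).map fun J => Finsupp.single (η p J) 1).sum
  map_zero' := by simp
  map_add' u v := by simp [Finset.sum_add_distrib]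

theorem tableMonomial_apply {I Y : Type*} [Fintype I] {K : ℕ} (η : I → (Fin K ↪ ℕ) → Y)
    (u : I → Multiset (Fin K ↪ ℕ)) :
    tableMonomial η u = ∑ p, ((u p).map fun J => Finsupp.single (η p J) 1).sum := rfl

theorem tableMonomial_surjective {I Y : Type*} [Fintype I] {K : ℕ} (η : I → (Fin K ↪ ℕ) → Y)
    (hη : ∀ y, ∃ p J, η p J = y) : Function.Surjective (tableMonomial η) := by
  classical
  intro f
  induction f using Finsupp.induction_linear with
  | zero => exact ⟨0, map_zero _⟩
  | add f g hf hg =>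
    obtain ⟨u, rfl⟩ := hf
    obtain ⟨v, rfl⟩ := hg
    exact ⟨u + v, map_add _ _ _⟩
  | single y n =>
    obtain ⟨p, J, rfl⟩ := hη y
    refine ⟨n • Pi.single p {J}, ?_⟩
    rw [map_nsmul, tableMonomial_apply, Finset.sum_eq_single p]
    · simp
    · intro q _ hq
      simp [hq]
    · simp

theorem mapDomain_tableMonomial {I Y : Type*} [Fintype I] {K : ℕ} (η : I → (Fin K ↪ ℕ) → Y)
    (π : ℕ ↪o ℕ) (f : Y → Y) (hf : ∀ p J, f (η p J) = η p (J.trans π.toEmbedding))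
    (u : I → Multiset (Fin K ↪ ℕ)) :
    (tableMonomial η u).mapDomain f = tableMonomial η (shiftTables π u) := by
  change Finsupp.mapDomain.addMonoidHom f (tableMonomial η u) = _
  rw [tableMonomial_apply, tableMonomial_apply, map_sum]
  refine Finset.sum_congr rfl fun p _ => ?_
  rw [map_multiset_sum, shiftTables, Multiset.map_map, Multiset.map_map]
  refine congrArg _ (Multiset.map_congr rfl fun J _ => ?_)
  simp [hf]

/-- The exponent of the image monomial in terms of the columns: an entry `j` in the column `l` of
the table with index `p` contributes the variables `x_{i,j}` with exponents `a p l i`. -/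
noncomputable def columnExponent {I : Type*} [Fintype I] {K k : ℕ} (a : I → Fin K → Fin k → ℕ) :
    (I → Fin K → Multiset ℕ) →+ (Fin k × ℕ →₀ ℕ) where
  toFun A := ∑ p, ∑ l, ((A p l).map fun j => ∑ i, Finsupp.single (i, j) (a p l i)).sum
  map_zero' := by simp
  map_add' A B := by simp only [Pi.add_apply, Multiset.map_add, Multiset.sum_add,
    Finset.sum_add_distrib]

theorem columnExponent_apply {I : Type*} [Fintype I] {K k : ℕ} (a : I → Fin K → Fin k → ℕ)
    (A : I → Fin K → Multiset ℕ) : columnExponent a A =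
      ∑ p, ∑ l, ((A p l).map fun j => ∑ i, Finsupp.single (i, j) (a p l i)).sum := rfl

theorem columnExponent_map {I : Type*} [Fintype I] {K k : ℕ} (a : I → Fin K → Fin k → ℕ)
    (π : ℕ ↪o ℕ) (A : I → Fin K → Multiset ℕ) :
    columnExponent a (fun p l => (A p l).map π) =
      (columnExponent a A).mapDomain (Prod.map id π) := by
  change _ = Finsupp.mapDomain.addMonoidHom (Prod.map id π) (columnExponent a A)
  simp only [columnExponent_apply, map_sum, map_multiset_sum, Multiset.map_map]
  simp

theorem monomial_add_one {R σ : Type*} [CommSemiring R] (f g : σ →₀ ℕ) :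
    (monomial (f + g) 1 : MvPolynomial σ R) = monomial f 1 * monomial g 1 := by
  rw [monomial_mul, one_mul]

theorem map_monomial_tableMonomial {R I Y : Type*} [CommRing R] [Fintype I] {K k : ℕ}
    (η : I → (Fin K ↪ ℕ) → Y) (a : I → Fin K → Fin k → ℕ)
    (φ : MvPolynomial Y R →ₐ[R] MvPolynomial (Fin k × ℕ) R)
    (hφ : ∀ p J, φ (X (η p J)) = monomial (∑ l, ∑ i, Finsupp.single (i, J l) (a p l i)) 1)
    (u : I → Multiset (Fin K ↪ ℕ)) :
    φ (monomial (tableMonomial η u) 1) =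
      monomial (columnExponent a (familyColumns I K u)) 1 := by
  rw [tableMonomial_apply, columnExponent_apply, monomial_sum_one, monomial_sum_one, map_prod]
  refine Finset.prod_congr rfl fun p _ => ?_
  rw [familyColumns_apply]
  induction u p using Multiset.induction_on with
  | empty => simp
  | cons J t ih =>
    simp only [tableColumns_cons, Multiset.map_cons, Multiset.sum_cons, Finset.sum_add_distrib]
    rw [monomial_add_one, map_mul, ih, monomial_add_one]
    exact congrArg (· * _) (hφ p J)

theorem exists_finset_binomials_ker_eq_span {R I Y : Type*} [CommRing R] [Nontrivial R] [Finite I]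
    {K k : ℕ} (hK : 0 < K) (η : I → (Fin K ↪ ℕ) → Y) (hη : ∀ y, ∃ p J, η p J = y)
    (incAct : (ℕ → ℕ) → Y → Y)
    (hinc : ∀ (π : ℕ ↪o ℕ) p J, incAct π (η p J) = η p (J.trans π.toEmbedding))
    (a : I → Fin K → Fin k → ℕ) (φ : MvPolynomial Y R →ₐ[R] MvPolynomial (Fin k × ℕ) R)
    (hφ : ∀ p J, φ (X (η p J)) = monomial (∑ l, ∑ i, Finsupp.single (i, J l) (a p l i)) 1) :
    ∃ B : Finset (MvPolynomial Y R),
      (∀ b ∈ B, b ∈ RingHom.ker φ ∧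
        ∃ u v : Y →₀ ℕ, b = monomial u 1 - monomial v 1) ∧
      RingHom.ker φ = Ideal.span
        {g | ∃ b ∈ B, ∃ π : ℕ → ℕ, StrictMono π ∧ g = rename (incAct π) b} := by
  classical
  have := Fintype.ofFinite I
  have hmap := map_monomial_tableMonomial η a φ hφ
  have hker : ∀ u v, columnExponent a (familyColumns I K u) =
      columnExponent a (familyColumns I K v) →
      (monomial (tableMonomial η u) 1 - monomial (tableMonomial η v) 1 : MvPolynomial Y R)
        ∈ RingHom.ker φ := fun u v h => by
    rw [RingHom.mem_ker, map_sub, hmap, hmap, h, sub_self]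
  have hequiv : ∀ (π : ℕ ↪o ℕ) (A B : I → Fin K → Multiset ℕ),
      columnExponent a (fun p l => (A p l).map π) = columnExponent a (fun p l => (B p l).map π) ↔
      columnExponent a A = columnExponent a B := fun π A B => by
    rw [columnExponent_map, columnExponent_map]
    exact (Finsupp.mapDomain_injective
      (Function.injective_id.prodMap π.injective)).eq_iff
  have hrename : ∀ (π : ℕ ↪o ℕ) u v, rename (incAct π)
      (monomial (tableMonomial η u) 1 - monomial (tableMonomial η v) 1 : MvPolynomial Y R) =
      monomial (tableMonomial η (shiftTables π u)) 1 -
        monomial (tableMonomial η (shiftTables π v)) 1 := fun π u v => by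
    rw [map_sub, rename_monomial, rename_monomial, mapDomain_tableMonomial η π _ (hinc π),
      mapDomain_tableMonomial η π _ (hinc π)]
  obtain ⟨B, hBfin, hB, hgen⟩ := exists_finite_generators_addCon hK (columnExponent a) hequiv
  refine ⟨hBfin.toFinset.image fun x =>
    monomial (tableMonomial η x.1) 1 - monomial (tableMonomial η x.2) 1, ?_, le_antisymm ?_ ?_⟩
  · intro b hb
    obtain ⟨x, hx, rfl⟩ := Finset.mem_image.1 hb
    exact ⟨hker _ _ (hB x (hBfin.mem_toFinset.1 hx)), _, _, rfl⟩
  · refine ker_le_of_binomials_mem φ (fun f => ?_) _ fun f g hfg => ?_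
    · obtain ⟨u, rfl⟩ := tableMonomial_surjective η hη f
      exact ⟨_, hmap u⟩
    · obtain ⟨u, rfl⟩ := tableMonomial_surjective η hη f
      obtain ⟨v, rfl⟩ := tableMonomial_surjective η hη g
      rw [hmap, hmap] at hfg
      refine hgen (idealAddCon _ (tableMonomial η)) (fun x hx π => ?_) u v
        (monomial_left_injective one_ne_zero hfg)
      refine Ideal.subset_span ⟨_, Finset.mem_image_of_mem _ (hBfin.mem_toFinset.2 hx), π,
        π.strictMono, ?_⟩
      rw [hrename]
  · rw [Ideal.span_le]
    rintro _ ⟨b, hb, π, hπ, rfl⟩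
    obtain ⟨x, hx, rfl⟩ := Finset.mem_image.1 hb
    have h := hrename (OrderEmbedding.ofStrictMono π hπ) x.1 x.2
    rw [OrderEmbedding.coe_ofStrictMono] at h
    rw [SetLike.mem_coe, h]
    refine hker _ _ ?_
    rw [familyColumns_shiftTables, familyColumns_shiftTables, hequiv]
    exact hB x (hBfin.mem_toFinset.1 hx)

theorem exists_perm_forall_apply_eq {n : ℕ} (J : Fin n ↪ ℕ) :
    ∃ σ : Equiv.Perm ℕ, ∀ l : Fin n, σ l = J l := by
  have := Equiv.Perm.isMultiplyPretransitive ℕ n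
  obtain ⟨σ, hσ⟩ := MulAction.exists_smul_eq (Equiv.Perm ℕ) Fin.valEmbedding J
  exact ⟨σ, fun l => DFunLike.congr_fun hσ l⟩

theorem mapDomain_eq_sum_columns {k K : ℕ} (m : Fin k × ℕ →₀ ℕ) (hm : ∀ q ∈ m.support, q.2 < K)
    (σ : ℕ → ℕ) : m.mapDomain (fun q : Fin k × ℕ => (q.1, σ q.2)) =
      ∑ l : Fin K, ∑ i, Finsupp.single (i, σ l) (m (i, l)) := by
  rw [Finsupp.mapDomain, Finsupp.sum_of_support_subset m
    (s := Finset.univ ×ˢ Finset.range K) (fun q hq => by simpa using hm q (by simpa using hq)) _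
    (by simp), Finset.sum_product_right, Finset.sum_range]

/-- Main Theorem, kernel part.  `Y` is a set with a `Sym(ℕ)`-action `act` such that each
`y ∈ Y` is fixed by all permutations fixing `[kb y]` pointwise, and with finitely many
orbits (witnessed by the finite set `reps` of representatives); `incAct` is the induced
action of the monoid `Inc(ℕ)` of strictly increasing maps `ℕ → ℕ` on `Y`.  If
`φ : R[Y] → R[X]`, with `X = [k] × ℕ`, is a `Sym(ℕ)`-equivariant `R`-algebra homomorphism
sending every variable `y` to a monomial in the variables `x_{i,j}`, then `ker φ` is
generated by finitely many `Inc(ℕ)`-orbits of binomials. -/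
theorem mainTheorem_kernel
    {R : Type} [CommRing R] [IsNoetherianRing R] (k : ℕ) {Y : Type}
    (act : Equiv.Perm ℕ → Y → Y)
    (act_one : ∀ y, act 1 y = y)
    (act_mul : ∀ σ τ y, act (σ * τ) y = act σ (act τ y))
    (kb : Y → ℕ)
    (hkb : ∀ (y : Y) (σ : Equiv.Perm ℕ), (∀ i < kb y, σ i = i) → act σ y = y)
    (reps : Finset Y)
    (hreps : ∀ y : Y, ∃ y₀ ∈ reps, ∃ σ : Equiv.Perm ℕ, act σ y₀ = y)
    (incAct : (ℕ → ℕ) → Y → Y)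
    (hincAct : ∀ (π : ℕ → ℕ), StrictMono π → ∀ (σ : Equiv.Perm ℕ) (y : Y),
      (∀ i < kb y, σ i = π i) → incAct π y = act σ y)
    (φ : MvPolynomial Y R →ₐ[R] MvPolynomial (Fin k × ℕ) R)
    (hequiv : ∀ (σ : Equiv.Perm ℕ) (f : MvPolynomial Y R),
      φ (rename (act σ) f) = rename (fun q : Fin k × ℕ => (q.1, σ q.2)) (φ f))
    (hmono : ∀ y : Y, ∃ m : Fin k × ℕ →₀ ℕ, φ (X y) = monomial m 1) :
    ∃ B : Finset (MvPolynomial Y R),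
      (∀ b ∈ B, b ∈ RingHom.ker φ ∧
        ∃ u v : Y →₀ ℕ, b = monomial u 1 - monomial v 1) ∧
      RingHom.ker φ = Ideal.span
        {g | ∃ b ∈ B, ∃ π : ℕ → ℕ, StrictMono π ∧ g = rename (incAct π) b} := by
  rcases subsingleton_or_nontrivial R with hR | hR
  · exact ⟨∅, by simp, Ideal.ext fun f => by rw [Subsingleton.elim f 0]; simp⟩
  choose m hm using hmono
  let K := reps.sup kb + reps.sup (fun y => (m y).support.sup Prod.snd) + 1
  have hkbK : ∀ p ∈ reps, kb p < K := fun p hp => by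
    have := Finset.le_sup (f := kb) hp
    omega
  have hmK : ∀ p ∈ reps, ∀ q ∈ (m p).support, q.2 < K := fun p hp q hq => by
    have h1 := Finset.le_sup (f := fun y => (m y).support.sup Prod.snd) hp
    have h2 := Finset.le_sup (f := Prod.snd) hq
    omega
  choose ext hext using fun J : Fin K ↪ ℕ => exists_perm_forall_apply_eq J
  let η : reps → (Fin K ↪ ℕ) → Y := fun p J => act (ext J) p
  have hη : ∀ (p : reps) (J : Fin K ↪ ℕ) (σ : Equiv.Perm ℕ), (∀ l : Fin K, σ l = J l) →
      act σ p = η p J := fun p J σ hσ => by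
    have h : act ((ext J)⁻¹ * σ) p = p := hkb _ _ fun i hi => by
      have hiK : i < K := hi.trans (hkbK p p.2)
      rw [Equiv.Perm.mul_apply, Equiv.Perm.inv_eq_iff_eq]
      exact (hσ ⟨i, hiK⟩).trans (hext J ⟨i, hiK⟩).symm
    calc act σ p = act (ext J) (act ((ext J)⁻¹ * σ) p) := by rw [← act_mul, mul_inv_cancel_left]
      _ = η p J := by rw [h]
  have hη_act : ∀ (τ : Equiv.Perm ℕ) (p : reps) (J J' : Fin K ↪ ℕ), (∀ l, τ (J l) = J' l) →
      act τ (η p J) = η p J' := fun τ p J J' h => by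
    rw [← act_mul]
    refine hη p J' _ fun l => ?_
    rw [Equiv.Perm.mul_apply, hext, h]
  refine exists_finset_binomials_ker_eq_span (Nat.succ_pos _ : 0 < K) η (fun y => ?_) incAct
    (fun π p J => ?_) (fun p l i => m p (i, l)) φ fun p J => ?_
  · obtain ⟨p, hp, σ, rfl⟩ := hreps y
    exact ⟨⟨p, hp⟩, Fin.valEmbedding.trans σ.toEmbedding, (hη ⟨p, hp⟩ _ σ fun l => rfl).symm⟩
  · let N := kb (η p J) + ∑ l, J l + 1
    obtain ⟨σ, hσ⟩ := exists_perm_forall_apply_eq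
      ((Fin.valEmbedding : Fin N ↪ ℕ).trans π.toEmbedding)
    have hσ' : ∀ i < N, σ i = π i := fun i hi => hσ ⟨i, hi⟩
    rw [hincAct π π.strictMono σ _ fun i hi => hσ' i (by omega)]
    refine hη_act σ p J _ fun l => hσ' _ ?_
    have := Finset.single_le_sum (f := fun l => J l) (fun _ _ => Nat.zero_le _)
      (Finset.mem_univ l)
    omega
  · have h := hequiv (ext J) (X (p : Y))
    rw [rename_X, hm (p : Y), rename_monomial, mapDomain_eq_sum_columns _ (hmK p p.2)] at h
    simpa only [hext] using h
end

section
/- Let R be a Noetherian commutative ring and k ∈ ℕ, with R[X] and its Sym(ℕ)- and Inc(ℕ)-actions as in the context, and let Y and R[Y] be as in the context. Let φ : R[Y] → R[X] be a Sym(ℕ)-equivariant R-algebra homomorphism that sends every variable y ∈ Y to a monomial (a finite product of the variables x_{i,j}). Then the image of φ is an R-subalgebra of R[X] that is stable under the Inc(ℕ)-action, and the ring im φ is Inc(ℕ)-Noetherian: every Inc(ℕ)-stable ideal of im φ is generated by the union of finitely many Inc(ℕ)-orbits of its elements. -/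
open MvPolynomial

/-- All rows of the finitely supported matrix `B` have sum `d` and all its columns have sum at
most `d`. -/
structure IsMatchingSum {n : ℕ} (B : Fin n → ℕ →₀ ℕ) (d : ℕ) : Prop where
  row : ∀ l, (B l).degree = d
  col : ∀ j, ∑ l, B l j ≤ d

namespace IsMatchingSum

variable {n d : ℕ} {B : Fin n → ℕ →₀ ℕ}

theorem sum_eq (hB : IsMatchingSum B d) {s : Finset ℕ} {l : Fin n} (hs : (B l).support ⊆ s) :
    ∑ j ∈ s, B l j = d := by
  rw [← hB.row l, Finsupp.degree_apply]
  exact (Finset.sum_subset hs fun j _ hj => Finsupp.notMem_support_iff.1 hj).symm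

theorem add {B' : Fin n → ℕ →₀ ℕ} {d' : ℕ} (hB : IsMatchingSum B d) (hB' : IsMatchingSum B' d') :
    IsMatchingSum (B + B') (d + d') where
  row l := by simp [hB.row l, hB'.row l]
  col j := by simpa [Finset.sum_add_distrib] using add_le_add (hB.col j) (hB'.col j)

theorem zero : IsMatchingSum (0 : Fin n → ℕ →₀ ℕ) 0 where
  row l := by simp
  col j := by simp

theorem of_injective {J : Fin n → ℕ} (hJ : J.Injective) :
    IsMatchingSum (fun l => Finsupp.single (J l) 1) 1 where
  row l := by simp
  col j := by
    simp only [Finsupp.single_apply, Finset.sum_boole, Nat.cast_id]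
    exact Finset.card_le_one.2 fun a ha b hb => hJ (by simp_all)

/-- A regular matrix contains a matching that meets every column of maximal sum. -/
theorem exists_matching (hB : IsMatchingSum B d) (hd : 0 < d) :
    ∃ J : Fin n → ℕ, J.Injective ∧ (∀ l, 0 < B l (J l)) ∧
      ∀ j, ∑ l, B l j = d → ∃ l, J l = j := by
  classical
  set C : Finset ℕ := Finset.univ.biUnion fun l => (B l).support with hC
  have hsub : ∀ l, (B l).support ⊆ C := fun l =>
    Finset.subset_biUnion_of_mem (fun l => (B l).support) (Finset.mem_univ l)
  have mass : ∀ (S₀ : Finset (Fin n)) (U : Finset ℕ), (∀ l ∈ S₀, (B l).support ⊆ U) →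
      S₀.card ≤ U.card := by
    intro S₀ U hU
    refine Nat.le_of_mul_le_mul_right ?_ hd
    calc S₀.card * d = ∑ l ∈ S₀, ∑ j ∈ U, B l j := by
          rw [Finset.sum_congr rfl fun l hl => hB.sum_eq (hU l hl)]; simp
      _ = ∑ j ∈ U, ∑ l ∈ S₀, B l j := Finset.sum_comm
      _ ≤ ∑ j ∈ U, d := Finset.sum_le_sum fun j _ =>
          (Finset.sum_le_sum_of_subset (Finset.subset_univ _)).trans (hB.col j)
      _ = U.card * d := by simp
  have hnC : n ≤ C.card := by simpa using mass Finset.univ C fun l _ => hsub l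
  let t : Fin n ⊕ Fin (C.card - n) → Finset ℕ :=
    Sum.elim (fun l => (B l).support) fun _ => C.filter fun j => ∑ l, B l j < d
  have htC : ∀ x, t x ⊆ C := by
    rintro (l | x)
    · exact hsub l
    · exact Finset.filter_subset _ _
  have hall : ∀ S : Finset (Fin n ⊕ Fin (C.card - n)), S.card ≤ (S.biUnion t).card := by
    intro S
    have hU : ∀ l ∈ S.toLeft, (B l).support ⊆ S.biUnion t := fun l hl =>
      Finset.subset_biUnion_of_mem t (Finset.mem_toLeft.1 hl)
    rw [← Finset.card_toLeft_add_card_toRight (u := S)]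
    rcases S.toRight.eq_empty_or_nonempty with hT | ⟨x, hx⟩
    · simpa [hT] using mass _ _ hU
    · have hxU : t (Sum.inr x) ⊆ S.biUnion t :=
        Finset.subset_biUnion_of_mem t (Finset.mem_toRight.1 hx)
      have hUC : S.biUnion t ⊆ C := Finset.biUnion_subset.2 fun x _ => htC x
      have key : (C \ S.biUnion t).card ≤ (S.toLeftᶜ).card := by
        refine Nat.le_of_mul_le_mul_right ?_ hd
        calc (C \ S.biUnion t).card * d = ∑ j ∈ C \ S.biUnion t, d := by simp
          _ ≤ ∑ j ∈ C \ S.biUnion t, ∑ l ∈ S.toLeftᶜ, B l j := by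
              refine Finset.sum_le_sum fun j hj => ?_
              rw [Finset.mem_sdiff] at hj
              have h1 : d ≤ ∑ l, B l j := by
                by_contra! hlt
                exact hj.2 (hxU (by simp [t, hj.1, hlt]))
              refine h1.trans (Finset.sum_subset (Finset.subset_univ _) fun l _ hl => ?_).ge
              by_contra h0
              exact hj.2 (hU l (by simpa using hl) (Finsupp.mem_support_iff.2 h0))
          _ = ∑ l ∈ S.toLeftᶜ, ∑ j ∈ C \ S.biUnion t, B l j := Finset.sum_comm
          _ ≤ ∑ l ∈ S.toLeftᶜ, d := Finset.sum_le_sum fun l _ => by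
              rw [← hB.sum_eq (hsub l)]
              exact Finset.sum_le_sum_of_subset Finset.sdiff_subset
          _ = (S.toLeftᶜ).card * d := by simp
      rw [Finset.card_compl, Fintype.card_fin, Finset.card_sdiff_of_subset hUC] at key
      have h1 : S.toLeft.card ≤ n := by simpa using Finset.card_le_univ S.toLeft
      have h2 : S.toRight.card ≤ C.card - n := by simpa using Finset.card_le_univ S.toRight
      have h3 := Finset.card_le_card hUC
      omega
  obtain ⟨f, hf, hft⟩ := (Finset.all_card_le_biUnion_card_iff_exists_injective t).1 hall
  have himg : Finset.univ.image f = C := by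
    refine Finset.eq_of_subset_of_card_le
      (Finset.image_subset_iff.2 fun x _ => htC x (hft x)) ?_
    rw [Finset.card_image_of_injective _ hf]
    simp [hnC]
  refine ⟨fun l => f (Sum.inl l), hf.comp Sum.inl_injective, fun l => ?_, fun j hj => ?_⟩
  · have := hft (Sum.inl l)
    exact Nat.pos_of_ne_zero (Finsupp.mem_support_iff.1 this)
  · have hjC : j ∈ C := by
      by_contra hjC
      rw [Finset.sum_eq_zero fun l _ =>
        Finsupp.notMem_support_iff.1 fun h => hjC (hsub l h)] at hj
      omega
    rw [← himg, Finset.mem_image] at hjC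
    obtain ⟨l | x, -, rfl⟩ := hjC
    · exact ⟨l, rfl⟩
    · have := hft (Sum.inr x)
      simp only [t, Sum.elim_inr, Finset.mem_filter] at this
      omega

/-- A regular matrix is a sum of matchings. -/
theorem mem_closure (hB : IsMatchingSum B d) :
    B ∈ AddSubmonoid.closure
      {G : Fin n → ℕ →₀ ℕ | ∃ J : Fin n → ℕ, J.Injective ∧ G = fun l => Finsupp.single (J l) 1} := by
  induction d generalizing B with
  | zero =>
    have : B = 0 := funext fun l => Finsupp.degree_eq_zero_iff (B l) |>.1 (hB.row l)
    exact this ▸ zero_mem _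
  | succ d ih =>
    obtain ⟨J, hJ, hpos, htight⟩ := hB.exists_matching d.succ_pos
    set G : Fin n → ℕ →₀ ℕ := fun l => Finsupp.single (J l) 1 with hG
    have hle : G ≤ B := fun l => Finsupp.single_le_iff.2 (hpos l)
    have heq : B - G + G = B := tsub_add_cancel_of_le hle
    have hMG : IsMatchingSum G 1 := of_injective hJ
    rw [← heq]
    refine add_mem (ih ⟨fun l => ?_, fun j => ?_⟩) (AddSubmonoid.subset_closure ⟨J, hJ, rfl⟩)
    · have := hB.row l
      rw [← heq, Pi.add_apply, map_add, hMG.row l] at this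
      omega
    · have h1 : ∑ l, B l j = ∑ l, (B - G) l j + ∑ l, G l j := by
        rw [← Finset.sum_add_distrib]
        exact Finset.sum_congr rfl fun l _ => by rw [← Finsupp.add_apply, ← Pi.add_apply, heq]
      have h2 := hB.col j
      rcases h2.eq_or_lt with h | h
      · obtain ⟨l, rfl⟩ := htight j h
        have : 1 ≤ ∑ l', G l' (J l) := by
          refine le_trans ?_ (Finset.single_le_sum (fun _ _ => Nat.zero_le _) (Finset.mem_univ l))
          simp [hG]
        omega
      · omega

end IsMatchingSum

theorem wellQuasiOrdered_eq_or_two_mul_le :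
    WellQuasiOrdered fun a b : ℕ => a = b ∨ 2 * a ≤ b := by
  intro f
  by_contra! h
  have hbd : ∀ n, f n ∈ Set.Iic (2 * f 0) := fun n => by
    rcases n.eq_zero_or_pos with rfl | hn
    · simp only [Set.mem_Iic]; omega
    · exact (h 0 n hn).2.le
  obtain ⟨m, n, hmn, he⟩ := (Set.finite_Iic (2 * f 0)).exists_lt_map_eq_of_forall_mem hbd
  exact (h m n hmn).1 he

/-- The matrices whose blocks are regular are well-quasi-ordered when one lies
below another if it has a column-shifted copy whose difference from the other is regular. -/
theorem exists_lt_eq_mapDomain_add {P : Type} [Fintype P] {κ : P → ℕ}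
    (A : ℕ → ∀ p, Fin (κ p) → ℕ →₀ ℕ) (d : ℕ → P → ℕ)
    (hA : ∀ n p, IsMatchingSum (A n p) (d n p)) :
    ∃ m n, m < n ∧ ∃ π : ℕ → ℕ, StrictMono π ∧ ∃ (C : ∀ p, Fin (κ p) → ℕ →₀ ℕ) (e : P → ℕ),
      (∀ p, IsMatchingSum (C p) (e p)) ∧
      ∀ p l, A n p l = (A m p l).mapDomain π + C p l := by
  classical
  have hN : ∀ n, ∃ N, ∀ p l j, A n p l j ≠ 0 → j < N := by
    intro n
    refine ⟨(Finset.univ.biUnion fun p => Finset.univ.biUnion fun l =>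
      (A n p l).support).sup id + 1, fun p l j hj => Nat.lt_succ_of_le ?_⟩
    refine Finset.le_sup (f := id) ?_
    simp only [Finset.mem_biUnion, Finset.mem_univ, true_and, Finsupp.mem_support_iff]
    exact ⟨p, l, hj⟩
  choose N hN using hN
  let colSum : ℕ → P → ℕ → ℕ := fun n p j => ∑ l, A n p l j
  have hcolN : ∀ n p j, colSum n p j ≠ 0 → j < N n := by
    intro n p j hj
    obtain ⟨l, -, hl⟩ := Finset.exists_ne_zero_of_sum_ne_zero hj
    exact hN n p l j hl
  let heavy : ℕ → P → Finset ℕ := fun n p =>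
    (Finset.range (N n)).filter fun j => d n p < 2 * colSum n p j
  have hheavy : ∀ n p j, j ∈ heavy n p ↔ d n p < 2 * colSum n p j := by
    intro n p j
    simp only [heavy, Finset.mem_filter, Finset.mem_range, and_iff_right_iff_imp]
    intro h
    exact hcolN n p j (by omega)
  have hcard : ∀ n p, (heavy n p).card < 2 * κ p + 1 := by
    intro n p
    rw [Nat.lt_succ_iff]
    rcases (d n p).eq_zero_or_pos with h0 | hpos
    · have : heavy n p = ∅ := Finset.eq_empty_of_forall_notMem fun j hj => by
        have h1 := (hheavy n p j).1 hj
        have h2 : colSum n p j ≤ d n p := (hA n p).col j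
        omega
      simp [this]
    · refine Nat.le_of_mul_le_mul_right ?_ hpos
      calc (heavy n p).card * d n p = ∑ j ∈ heavy n p, d n p := by simp
        _ ≤ ∑ j ∈ heavy n p, 2 * colSum n p j :=
            Finset.sum_le_sum fun j hj => ((hheavy n p j).1 hj).le
        _ ≤ ∑ j ∈ Finset.range (N n), 2 * colSum n p j :=
            Finset.sum_le_sum_of_subset (Finset.filter_subset _ _)
        _ = 2 * ∑ l, ∑ j ∈ Finset.range (N n), A n p l j := by
            rw [← Finset.mul_sum, Finset.sum_comm]
        _ = 2 * ∑ l : Fin (κ p), d n p := by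
            congr 1
            refine Finset.sum_congr rfl fun l _ => (hA n p).sum_eq fun j hj => ?_
            exact Finset.mem_range.2 (hN n p l j (Finsupp.mem_support_iff.1 hj))
        _ = 2 * κ p * d n p := by simp [mul_assoc]
  let letter : ℕ → ℕ → (∀ p, Fin (κ p) → ℕ) × (P → ℕ) × (P → ℕ) := fun n j =>
    (fun p l => A n p l j, fun p => d n p - colSum n p j,
      fun p => if j ∈ heavy n p then 1 else 0)
  have hwords : WellQuasiOrdered (List.SublistForall₂
      fun a b : (∀ p, Fin (κ p) → ℕ) × (P → ℕ) × (P → ℕ) => a ≤ b) := by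
    have h := Set.PartiallyWellOrderedOn.partiallyWellOrderedOn_sublistForall₂
      (fun a b : (∀ p, Fin (κ p) → ℕ) × (P → ℕ) × (P → ℕ) => a ≤ b)
      (s := Set.univ) (fun f => wellQuasiOrdered_le fun n => (f n).1)
    exact fun f => h fun n => ⟨f n, fun _ _ => Set.mem_univ _⟩
  have hr : IsPreorder ℕ fun a b : ℕ => a = b ∨ 2 * a ≤ b :=
    { refl := fun a => Or.inl rfl
      trans := fun a b c h1 h2 => by omega }
  have hdeg : WellQuasiOrdered fun a b : P → ℕ => ∀ p, a p = b p ∨ 2 * a p ≤ b p :=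
    WellQuasiOrdered.pi fun _ => wellQuasiOrdered_eq_or_two_mul_le
  have hr' : IsPreorder (P → ℕ) fun a b : P → ℕ => ∀ p, a p = b p ∨ 2 * a p ≤ b p :=
    { refl := fun a p => Or.inl rfl
      trans := fun a b c h1 h2 p => by have := h1 p; have := h2 p; omega }
  have hcnt : WellQuasiOrdered fun a b : (∀ p, Fin (2 * κ p + 1)) => a = b :=
    Finite.wellQuasiOrdered _
  obtain ⟨m, n, hmn, hd, hc, hw⟩ := (hdeg.prod (hcnt.prod hwords)) fun n =>
    (d n, fun p => ⟨(heavy n p).card, hcard n p⟩, (List.range (N n)).map (letter n))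
  simp only at hd hc hw
  obtain ⟨w, hw1, hw2⟩ := List.sublistForall₂_iff.1 hw
  obtain ⟨π, hπ⟩ := List.sublist_iff_exists_orderEmbedding_getElem?_eq.1 hw2
  have hlen : w.length = N m := by simpa using hw1.length_eq.symm
  have hd' : ∀ p, d m p ≤ d n p := fun p => by have := hd p; omega
  have hletter : ∀ j < N m, letter m j ≤ letter n (π j) := by
    intro j hj
    have h1 := hπ j
    rw [List.getElem?_eq_getElem (by omega)] at h1
    have h2 := List.getElem?_eq_some_iff.1 h1.symm
    obtain ⟨h3, h4⟩ := h2
    have h5 := (List.forall₂_iff_get.1 hw1).2 j (by simpa using hj) (by omega)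
    simp only [List.get_eq_getElem, List.getElem_map, List.getElem_range] at h4 h5
    rwa [← h4] at h5
  have hle : ∀ p l j, A m p l j ≤ A n p l (π j) := by
    intro p l j
    by_cases h0 : A m p l j = 0
    · simp [h0]
    · exact (hletter j (hN m p l j h0)).1 p l
  have hslack : ∀ p j, d m p - colSum m p j ≤ d n p - colSum n p (π j) := by
    intro p j
    by_cases hj : j < N m
    · exact (hletter j hj).2.1 p
    · have h1 := hπ j
      rw [List.getElem?_eq_none (by omega), eq_comm, List.getElem?_eq_none_iff] at h1
      have : colSum n p (π j) = 0 := by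
        by_contra h0
        have := hcolN n p _ h0
        simp at h1
        omega
      have := hd' p
      omega
  have hhit : ∀ p y, y ∈ heavy n p → ∃ x, π x = y := by
    intro p y hy
    have hsub : (heavy m p).image π ⊆ heavy n p := by
      intro z hz
      obtain ⟨x, hx, rfl⟩ := Finset.mem_image.1 hz
      have h1 := (hletter x (by simpa using (Finset.mem_filter.1 hx).1)).2.2 p
      by_contra hz'
      simp [letter, hx, hz'] at h1
    have hcd : (heavy m p).card = (heavy n p).card := by
      simpa using congrArg Fin.val (congrFun hc p)
    have := Finset.eq_of_subset_of_card_le hsub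
      (by rw [Finset.card_image_of_injective _ π.injective, hcd])
    rw [← this] at hy
    obtain ⟨x, -, hx⟩ := Finset.mem_image.1 hy
    exact ⟨x, hx⟩
  have hmap : ∀ p l, (A m p l).mapDomain π ≤ A n p l := by
    intro p l y
    by_cases hy : y ∈ Set.range π
    · obtain ⟨x, rfl⟩ := hy
      rw [Finsupp.mapDomain_apply π.injective]
      exact hle p l x
    · rw [Finsupp.mapDomain_of_notMem_range _ _ hy]
      exact Nat.zero_le _
  have heq : ∀ p l, A n p l = (A m p l).mapDomain π + (A n p l - (A m p l).mapDomain π) :=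
    fun p l => (add_tsub_cancel_of_le (hmap p l)).symm
  have hrow : ∀ p l, (A n p l - (A m p l).mapDomain π).degree = d n p - d m p := by
    intro p l
    have h1 := congrArg Finsupp.degree (heq p l)
    rw [map_add, (hA n p).row l, Finsupp.degree_mapDomain, (hA m p).row l] at h1
    omega
  refine ⟨m, n, hmn, π, π.strictMono, fun p l => A n p l - (A m p l).mapDomain π,
    fun p => d n p - d m p, fun p => ⟨hrow p, fun y => ?_⟩, heq⟩
  beta_reduce
  rcases hd p with hdp | hdp
  · refine (Finset.sum_eq_zero fun l _ => ?_).trans_le (Nat.zero_le _)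
    have h1 := hrow p l
    rw [hdp, Nat.sub_self, Finsupp.degree_eq_zero_iff] at h1
    simp only [h1, Finsupp.coe_zero, Pi.zero_apply]
  · have hsum : colSum n p y = ∑ l, (A m p l).mapDomain π y +
        ∑ l, (A n p l - (A m p l).mapDomain π) y := by
      rw [← Finset.sum_add_distrib]
      refine Finset.sum_congr rfl fun l _ => ?_
      rw [← Finsupp.add_apply, ← heq]
    have hbn : colSum n p y ≤ d n p := (hA n p).col y
    by_cases hy : y ∈ Set.range π
    · obtain ⟨x, rfl⟩ := hy
      have h1 : ∑ l, (A m p l).mapDomain π (π x) = colSum m p x :=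
        Finset.sum_congr rfl fun l _ => Finsupp.mapDomain_apply π.injective _ _
      have h2 := hslack p x
      have h3 : colSum m p x ≤ d m p := (hA m p).col x
      have h4 := hd' p
      omega
    · have h1 : ¬ d n p < 2 * colSum n p y := fun h =>
        hy (hhit p y ((hheavy n p y).2 h))
      omega

/-- The map on variable indices that applies `π` to the column index. -/
abbrev colMap {ι : Type} (π : ℕ → ℕ) : ι × ℕ → ι × ℕ := fun q => (q.1, π q.2)

theorem colMap_injective {ι : Type} {π : ℕ → ℕ} (hπ : π.Injective) :
    (colMap π : ι × ℕ → ι × ℕ).Injective := by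
  rintro ⟨i, j⟩ ⟨i', j'⟩ h
  simp only [colMap, Prod.mk.injEq] at h
  exact Prod.ext h.1 (hπ h.2)

section MonomialOrder

variable {k : ℕ}

/-- Exponents, ordered lexicographically with the variables of the last columns dominating. -/
noncomputable def colexExp (a : Fin k × ℕ →₀ ℕ) : Colex (ℕ ×ₗ Fin k →₀ ℕ) :=
  toColex (Finsupp.domCongr ((Equiv.prodComm _ _).trans toLex) a)

theorem colexExp_lt_iff {a b : Fin k × ℕ →₀ ℕ} : colexExp a < colexExp b ↔
    ∃ q : Fin k × ℕ, (∀ q' : Fin k × ℕ, toLex (q.2, q.1) < toLex (q'.2, q'.1) → a q' = b q') ∧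
      a q < b q := by
  rw [Finsupp.Colex.lt_iff]
  constructor
  · rintro ⟨i, h1, h2⟩
    exact ⟨((ofLex i).2, (ofLex i).1), fun q' hq' => h1 (toLex (q'.2, q'.1)) hq', h2⟩
  · rintro ⟨q, h1, h2⟩
    exact ⟨toLex (q.2, q.1), fun j hj => h1 ((ofLex j).2, (ofLex j).1) hj, h2⟩

theorem colexExp_injective : (colexExp : (Fin k × ℕ →₀ ℕ) → _).Injective := fun _ _ h =>
  (Finsupp.domCongr ((Equiv.prodComm (Fin k) ℕ).trans toLex)).injective (toColex.injective h)

theorem colexExp_add_lt_add_right {a b : Fin k × ℕ →₀ ℕ} (h : colexExp a < colexExp b)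
    (c : Fin k × ℕ →₀ ℕ) : colexExp (a + c) < colexExp (b + c) := by
  rw [colexExp_lt_iff] at h ⊢
  obtain ⟨q, h1, h2⟩ := h
  exact ⟨q, fun q' hq' => by simp [h1 q' hq'], by simpa using h2⟩

theorem colexExp_mapDomain_lt {a b : Fin k × ℕ →₀ ℕ} (h : colexExp a < colexExp b)
    {π : ℕ → ℕ} (hπ : StrictMono π) :
    colexExp (a.mapDomain (colMap π)) < colexExp (b.mapDomain (colMap π)) := by
  have hinj := colMap_injective (ι := Fin k) hπ.injective
  rw [colexExp_lt_iff] at h ⊢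
  obtain ⟨q, h1, h2⟩ := h
  refine ⟨colMap π q, fun q' hq' => ?_, ?_⟩
  · by_cases hr : q' ∈ Set.range (colMap π : Fin k × ℕ → Fin k × ℕ)
    · obtain ⟨q', rfl⟩ := hr
      rw [Finsupp.mapDomain_apply hinj, Finsupp.mapDomain_apply hinj]
      refine h1 q' ?_
      simpa only [Prod.Lex.toLex_lt_toLex, colMap, hπ.lt_iff_lt, hπ.injective.eq_iff] using hq'
    · rw [Finsupp.mapDomain_of_notMem_range _ _ hr, Finsupp.mapDomain_of_notMem_range _ _ hr]
  · rwa [Finsupp.mapDomain_apply hinj, Finsupp.mapDomain_apply hinj]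

end MonomialOrder

section LeadingCoefficients

variable {R : Type} [CommRing R] {k : ℕ} {A : Subalgebra R (MvPolynomial (Fin k × ℕ) R)}

/-- The ideal of the coefficients at `b` of the elements of `I` all of whose exponents are at
most `b`. -/
noncomputable def leadCoeffIdeal (I : Ideal A) (b : Fin k × ℕ →₀ ℕ) : Ideal R where
  carrier := {r | ∃ f ∈ I,
    (∀ a, coeff a (f : MvPolynomial (Fin k × ℕ) R) ≠ 0 → colexExp a ≤ colexExp b) ∧
      coeff b (f : MvPolynomial (Fin k × ℕ) R) = r}
  zero_mem' := ⟨0, zero_mem _, by simp, by simp⟩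
  add_mem' := by
    rintro _ _ ⟨f, hf, hf', rfl⟩ ⟨g, hg, hg', rfl⟩
    refine ⟨f + g, add_mem hf hg, fun a ha => ?_, by simp⟩
    by_cases h : coeff a (f : MvPolynomial (Fin k × ℕ) R) = 0
    · exact hg' a fun h' => ha (by simp [h, h'])
    · exact hf' a h
  smul_mem' := by
    rintro c _ ⟨f, hf, hf', rfl⟩
    refine ⟨c • f, by rw [Algebra.smul_def]; exact I.mul_mem_left _ hf,
      fun a ha => hf' a fun h => ha (by simp [h]), by simp⟩

theorem mem_leadCoeffIdeal {I : Ideal A} {b : Fin k × ℕ →₀ ℕ} {r : R} :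
    r ∈ leadCoeffIdeal I b ↔ ∃ f ∈ I,
    (∀ a, coeff a (f : MvPolynomial (Fin k × ℕ) R) ≠ 0 → colexExp a ≤ colexExp b) ∧
      coeff b (f : MvPolynomial (Fin k × ℕ) R) = r := Iff.rfl

theorem exists_leading_exponent {f : A} (hf : f ≠ 0) :
    ∃ b, coeff b (f : MvPolynomial (Fin k × ℕ) R) ≠ 0 ∧
      ∀ a, coeff a (f : MvPolynomial (Fin k × ℕ) R) ≠ 0 → colexExp a ≤ colexExp b := by
  have hne : (f : MvPolynomial (Fin k × ℕ) R).support.Nonempty := by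
    rw [Finset.nonempty_iff_ne_empty, Ne, MvPolynomial.support_eq_empty]
    simpa using hf
  obtain ⟨b, hb, hmax⟩ := Finset.exists_max_image _ colexExp hne
  exact ⟨b, mem_support_iff.1 hb, fun a ha => hmax a (mem_support_iff.2 ha)⟩

/-- An ideal is determined by its leading coefficients. -/
theorem le_of_leadCoeffIdeal_le {I J : Ideal A} (hJI : J ≤ I)
    (h : ∀ f ∈ I, ∀ b, coeff b (f : MvPolynomial (Fin k × ℕ) R) ≠ 0 →
      leadCoeffIdeal I b ≤ leadCoeffIdeal J b) : I ≤ J := by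
  suffices ∀ (o : Colex (ℕ ×ₗ Fin k →₀ ℕ)), ∀ f ∈ I, ∀ b,
      coeff b (f : MvPolynomial (Fin k × ℕ) R) ≠ 0 →
      (∀ a, coeff a (f : MvPolynomial (Fin k × ℕ) R) ≠ 0 → colexExp a ≤ colexExp b) →
      colexExp b = o → f ∈ J by
    intro f hf
    by_cases h0 : f = 0
    · exact h0 ▸ zero_mem J
    obtain ⟨b, hb, hmax⟩ := exists_leading_exponent h0
    exact this _ f hf b hb hmax rfl
  intro o
  induction o using WellFoundedLT.induction with
  | ind o ih =>
  rintro f hf b hb hmax rfl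
  obtain ⟨g, hg, hgb, hgf⟩ := h f hf b hb ⟨f, hf, hmax, rfl⟩
  have hlt : ∀ a, coeff a ((f - g : A) : MvPolynomial (Fin k × ℕ) R) ≠ 0 →
      colexExp a < colexExp b := by
    intro a ha
    refine lt_of_le_of_ne ?_ fun hab => ?_
    · by_cases h' : coeff a (f : MvPolynomial (Fin k × ℕ) R) = 0
      · exact hgb a fun h'' => ha (by simp [h', h''])
      · exact hmax a h'
    · obtain rfl := colexExp_injective hab
      exact ha (by simp [hgf])
  have hfg : f - g ∈ J := by
    by_cases h1 : f - g = 0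
    · exact h1 ▸ zero_mem J
    obtain ⟨c, hc, hcmax⟩ := exists_leading_exponent h1
    exact ih _ (hlt c hc) _ (sub_mem hf (hJI hg)) c hc hcmax rfl
  simpa using add_mem hfg hg

theorem leadCoeffIdeal_le_of_eq {J : Ideal A}
    (hJ : ∀ π : ℕ → ℕ, StrictMono π → ∀ x ∈ J, ∃ y ∈ J,
      (y : MvPolynomial (Fin k × ℕ) R) = rename (colMap π) (x : MvPolynomial (Fin k × ℕ) R))
    {a b c : Fin k × ℕ →₀ ℕ} {π : ℕ → ℕ} (hπ : StrictMono π)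
    (hc : monomial c (1 : R) ∈ A) (hb : b = a.mapDomain (colMap π) + c) :
    leadCoeffIdeal J a ≤ leadCoeffIdeal J b := by
  rintro _ ⟨f, hf, hfa, rfl⟩
  obtain ⟨g, hg, hgf⟩ := hJ π hπ f hf
  have hinj := colMap_injective (ι := Fin k) hπ.injective
  refine ⟨g * ⟨monomial c 1, hc⟩, J.mul_mem_right _ hg, fun a' ha' => ?_, ?_⟩
  · simp only [MulMemClass.coe_mul, coeff_mul_monomial', mul_one] at ha'
    obtain ⟨hca, ha'⟩ := ite_ne_right_iff.1 ha'
    rw [hgf] at ha'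
    obtain ⟨u, hu, hu'⟩ := coeff_rename_ne_zero _ _ _ ha'
    have h1 : a' = u.mapDomain (colMap π) + c := by
      rw [hu, tsub_add_cancel_of_le hca]
    rw [h1, hb]
    rcases (hfa u hu').eq_or_lt with h | h
    · rw [colexExp_injective h]
    · exact (colexExp_add_lt_add_right (colexExp_mapDomain_lt h hπ) c).le
  · simp only [MulMemClass.coe_mul]
    rw [hb, coeff_mul_monomial, mul_one, hgf, coeff_rename_mapDomain _ hinj]

/-- A subalgebra spanned by the monomials with exponents in a column-shift stable and
well-quasi-ordered monoid is Noetherian up to column shifts. -/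
theorem exists_finset_span_of_wellQuasiOrdered [IsNoetherianRing R]
    (M : AddSubmonoid (Fin k × ℕ →₀ ℕ))
    (hA : ∀ f, f ∈ A ↔ ∀ b, coeff b f ≠ 0 → b ∈ M)
    (hM : ∀ π : ℕ → ℕ, StrictMono π → ∀ a ∈ M, a.mapDomain (colMap π) ∈ M)
    (hwqo : WellQuasiOrdered fun a b : M => ∃ π : ℕ → ℕ, StrictMono π ∧ ∃ c ∈ M,
      (b : Fin k × ℕ →₀ ℕ) = (a : Fin k × ℕ →₀ ℕ).mapDomain (colMap π) + c)
    (I : Ideal A)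
    (hI : ∀ π : ℕ → ℕ, StrictMono π → ∀ x ∈ I, ∀ y : A,
      (y : MvPolynomial (Fin k × ℕ) R) = rename (colMap π) (x : MvPolynomial (Fin k × ℕ) R) →
        y ∈ I) :
    ∃ F : Finset A, (↑F : Set A) ⊆ (I : Set A) ∧
      I = Ideal.span {g : A | ∃ f ∈ F, ∃ π : ℕ → ℕ, StrictMono π ∧
        (g : MvPolynomial (Fin k × ℕ) R) =
          rename (colMap π) (f : MvPolynomial (Fin k × ℕ) R)} := by
  classical
  have hmon : ∀ c ∈ M, monomial c (1 : R) ∈ A := by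
    intro c hc
    refine (hA _).2 fun b hb => ?_
    rw [coeff_monomial] at hb
    exact (ite_ne_right_iff.1 hb).1 ▸ hc
  have hren : ∀ π : ℕ → ℕ, StrictMono π → ∀ f : A,
      rename (colMap π) (f : MvPolynomial (Fin k × ℕ) R) ∈ A := by
    intro π hπ f
    refine (hA _).2 fun b hb => ?_
    obtain ⟨u, rfl, hu⟩ := coeff_rename_ne_zero _ _ _ hb
    exact hM π hπ u ((hA _).1 f.2 u hu)
  let r : M → M → Prop := fun a b => ∃ π : ℕ → ℕ, StrictMono π ∧ ∃ c ∈ M,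
      (b : Fin k × ℕ →₀ ℕ) = (a : Fin k × ℕ →₀ ℕ).mapDomain (colMap π) + c
  have hpre : IsPreorder M r :=
    { refl := fun a => ⟨id, strictMono_id, 0, zero_mem _, by
        rw [add_zero]; exact Finsupp.mapDomain_id.symm⟩
      trans := by
        rintro a b d ⟨π, hπ, c, hc, hb⟩ ⟨ρ, hρ, c', hc', hd⟩
        refine ⟨ρ ∘ π, hρ.comp hπ, c.mapDomain (colMap ρ) + c',
          add_mem (hM ρ hρ c hc) hc', ?_⟩
        rw [hd, hb, Finsupp.mapDomain_add, ← Finsupp.mapDomain_comp, add_assoc]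
        rfl }
  have hmono : ∀ J : Ideal A, (∀ π : ℕ → ℕ, StrictMono π → ∀ x ∈ J, ∃ y ∈ J,
      (y : MvPolynomial (Fin k × ℕ) R) = rename (colMap π) (x : MvPolynomial (Fin k × ℕ) R)) →
      ∀ a b : M, r a b → leadCoeffIdeal J a ≤ leadCoeffIdeal J b := by
    rintro J hJ a b ⟨π, hπ, c, hc, hb⟩
    exact leadCoeffIdeal_le_of_eq hJ hπ (hmon c hc) hb
  have hImono := hmono I fun π hπ x hx =>
    ⟨⟨_, hren π hπ x⟩, hI π hπ x hx _ rfl, rfl⟩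
  obtain ⟨E, hE⟩ : ∃ E : Finset M, ∀ b : M, ∃ a ∈ E, r a b ∧
      leadCoeffIdeal I b = leadCoeffIdeal I a := by
    by_contra! hcon
    obtain ⟨s, -, hs⟩ := exists_seq_of_forall_finset_exists (fun _ : M => True)
      (fun a b => r a b → leadCoeffIdeal I b ≠ leadCoeffIdeal I a)
      fun E _ => (hcon E).imp fun b hb => ⟨trivial, hb⟩
    obtain ⟨g, hg⟩ := WellQuasiOrdered.exists_monotone_subseq (r := r) hwqo s
    obtain ⟨n, hn⟩ := monotone_stabilizes_iff_noetherian.2 (inferInstanceAs (IsNoetherian R R))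
      ⟨fun n => leadCoeffIdeal I (s (g n) : Fin k × ℕ →₀ ℕ),
        fun m n hmn => hImono _ _ (hg m n hmn)⟩
    exact hs (g n) (g (n + 1)) (g.strictMono n.lt_succ_self) (hg _ _ n.le_succ)
      (hn (n + 1) n.le_succ).symm
  have hgen : ∀ a : M, ∃ F : Finset A, (↑F : Set A) ⊆ (I : Set A) ∧
      ∀ J : Ideal A, (↑F : Set A) ⊆ J → leadCoeffIdeal I a ≤ leadCoeffIdeal J a := by
    intro a
    obtain ⟨T, hT⟩ := (isNoetherianRing_iff_ideal_fg R).1 inferInstance (leadCoeffIdeal I a)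
    have hTI : ∀ t : T, (t : R) ∈ leadCoeffIdeal I a := fun t =>
      hT ▸ Ideal.subset_span t.2
    choose f hf hfa hft using hTI
    refine ⟨Finset.univ.image f, fun x hx => ?_, fun J hJ => ?_⟩
    · obtain ⟨t, -, rfl⟩ := Finset.mem_image.1 hx
      exact hf t
    · rw [← hT]
      refine Ideal.span_le.2 fun t ht => ?_
      exact ⟨f ⟨t, ht⟩, hJ (by simp), hfa _, hft ⟨t, ht⟩⟩
  choose F hFI hF using hgen
  have hFI' : (↑(E.biUnion F) : Set A) ⊆ (I : Set A) := by
    intro x hx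
    obtain ⟨a, -, hx⟩ := Finset.mem_biUnion.1 hx
    exact hFI a hx
  refine ⟨E.biUnion F, hFI', le_antisymm ?_ (Ideal.span_le.2 ?_)⟩
  · set G : Set A := {g : A | ∃ f ∈ E.biUnion F, ∃ π : ℕ → ℕ, StrictMono π ∧
      (g : MvPolynomial (Fin k × ℕ) R) = rename (colMap π) (f : MvPolynomial (Fin k × ℕ) R)}
    have hGI : Ideal.span G ≤ I := Ideal.span_le.2 fun g ⟨f, hf, π, hπ, hg⟩ =>
      hI π hπ f (hFI' hf) g hg
    have hG : ∀ π : ℕ → ℕ, StrictMono π → ∀ x ∈ Ideal.span G, ∃ y ∈ Ideal.span G,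
        (y : MvPolynomial (Fin k × ℕ) R) =
          rename (colMap π) (x : MvPolynomial (Fin k × ℕ) R) := by
      intro π hπ x hx
      let ρ : A →ₐ[R] A := ((rename (colMap π)).comp A.val).codRestrict A (hren π hπ)
      have hle : Ideal.span G ≤ (Ideal.span G).comap ρ := by
        refine Ideal.span_le.2 fun g ⟨f, hf, τ, hτ, hg⟩ => Ideal.subset_span ?_
        refine ⟨f, hf, π ∘ τ, hπ.comp hτ, ?_⟩
        change rename (colMap π) (g : MvPolynomial (Fin k × ℕ) R) = _
        rw [hg, rename_rename]
        rfl
      exact ⟨ρ x, hle hx, rfl⟩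
    refine le_of_leadCoeffIdeal_le hGI fun f hf b hb => ?_
    obtain ⟨a, ha, hab, hIab⟩ := hE ⟨b, (hA _).1 f.2 b hb⟩
    refine (hIab.trans_le (hF a _ fun x hx => Ideal.subset_span ?_)).trans (hmono _ hG _ _ hab)
    refine ⟨x, Finset.mem_biUnion.2 ⟨a, ha, hx⟩, id, strictMono_id, ?_⟩
    exact (rename_id_apply _).symm
  · rintro g ⟨f, hf, π, hπ, hg⟩
    exact hI π hπ f (hFI' hf) g hg

end LeadingCoefficients

section MatrixExponents

variable {k n : ℕ} (v : Fin k × ℕ →₀ ℕ)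

/-- The exponent that has column `l` of `v` as its column `j` and is zero elsewhere. -/
noncomputable def colWeight (l j : ℕ) : Fin k × ℕ →₀ ℕ :=
  ∑ i, Finsupp.single (i, j) (v (i, l))

theorem mapDomain_colWeight (π : ℕ → ℕ) (l j : ℕ) :
    (colWeight v l j).mapDomain (colMap π) = colWeight v l (π j) := by
  simp [colWeight, Finsupp.mapDomain_finsetSum, colMap]

theorem mapDomain_eq_sum_colWeight (hv : ∀ q, v q ≠ 0 → q.2 < n) (τ : ℕ → ℕ) :
    v.mapDomain (colMap τ) = ∑ l : Fin n, colWeight v l (τ l) := by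
  have h : v = ∑ l : Fin n, colWeight v l l := by
    ext ⟨i, j⟩
    simp only [colWeight, Finsupp.finsetSum_apply, Finsupp.single_apply, Prod.mk.injEq]
    by_cases hj : j < n
    · rw [Finset.sum_eq_single ⟨j, hj⟩, Finset.sum_eq_single i] <;>
        simp +contextual [Fin.ext_iff]
    · have h0 : v (i, j) = 0 := by
        by_contra h0
        exact hj (hv _ h0)
      rw [h0]
      refine (Finset.sum_eq_zero fun l _ => Finset.sum_eq_zero fun i' _ => if_neg ?_).symm
      rintro ⟨-, rfl⟩
      exact hj l.2
  conv_lhs => rw [h]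
  simp [Finsupp.mapDomain_finsetSum, mapDomain_colWeight]

/-- The exponent obtained by summing, over the entries `(l, j)` of a matrix, the copies of
column `l` of `v` placed in column `j`. -/
noncomputable def matrixExp (n : ℕ) : (Fin n → ℕ →₀ ℕ) →+ (Fin k × ℕ →₀ ℕ) :=
  ∑ l : Fin n, (Finsupp.linearCombination ℕ (colWeight v l)).toAddMonoidHom.comp
    (Pi.evalAddMonoidHom _ l)

theorem matrixExp_apply (B : Fin n → ℕ →₀ ℕ) :
    matrixExp v n B = ∑ l : Fin n, Finsupp.linearCombination ℕ (colWeight v l) (B l) := by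
  simp [matrixExp, AddMonoidHom.finsetSum_apply]

theorem matrixExp_single (J : Fin n → ℕ) :
    matrixExp v n (fun l => Finsupp.single (J l) 1) = ∑ l : Fin n, colWeight v l (J l) := by
  simp [matrixExp_apply]

theorem matrixExp_mapDomain (B : Fin n → ℕ →₀ ℕ) (π : ℕ → ℕ) :
    matrixExp v n (fun l => (B l).mapDomain π) = (matrixExp v n B).mapDomain (colMap π) := by
  simp only [matrixExp_apply, Finsupp.mapDomain_finsetSum]
  refine Finset.sum_congr rfl fun l _ => ?_
  rw [Finsupp.linearCombination_mapDomain]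
  simp only [Finsupp.linearCombination_apply, Finsupp.sum, Finsupp.mapDomain_finsetSum,
    Finsupp.mapDomain_smul, mapDomain_colWeight, Function.comp_apply]

end MatrixExponents

theorem exists_perm_extending {n : ℕ} {J : Fin n → ℕ} (hJ : J.Injective) :
    ∃ σ : Equiv.Perm ℕ, ∀ l : Fin n, σ l = J l := by
  have := (MulAction.isMultiplyPretransitive_iff (G := Equiv.Perm ℕ) (α := ℕ) (n := n)).1
    (Equiv.Perm.isMultiplyPretransitive ℕ n)
  obtain ⟨σ, hσ⟩ := this Fin.valEmbedding ⟨J, hJ⟩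
  exact ⟨σ, fun l => DFunLike.congr_fun hσ l⟩

section Image

variable {k : ℕ} {Y : Type} {act : Equiv.Perm ℕ → Y → Y} {kb : Y → ℕ}
  {e : Y → Fin k × ℕ →₀ ℕ}

theorem lt_of_apply_ne_zero
    (hkb : ∀ (y : Y) (σ : Equiv.Perm ℕ), (∀ i < kb y, σ i = i) → act σ y = y)
    (he : ∀ (σ : Equiv.Perm ℕ) y, e (act σ y) = (e y).mapDomain (colMap σ))
    (y : Y) (q : Fin k × ℕ) (hq : e y q ≠ 0) : q.2 < kb y := by
  classical
  by_contra! hlt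
  obtain ⟨i, j⟩ := q
  obtain ⟨N, hN⟩ := Infinite.exists_notMem_finset
    ((e y).support.image Prod.snd ∪ Finset.range (kb y))
  simp only [Finset.mem_union, Finset.mem_image, Finset.mem_range, not_or, not_lt] at hN
  have h1 := he (Equiv.swap j N) y
  rw [hkb y _ fun x hx => Equiv.swap_apply_of_ne_of_ne (by simp at hlt; omega) (by omega)] at h1
  have h2 := DFunLike.congr_fun h1 (colMap (Equiv.swap j N) (i, j))
  rw [Finsupp.mapDomain_apply (colMap_injective (Equiv.injective _))] at h2
  refine hN.1 ⟨_, Finsupp.mem_support_iff.2 (h2 ▸ hq), ?_⟩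
  simp

theorem exists_act_eq_mapDomain
    (he : ∀ (σ : Equiv.Perm ℕ) y, e (act σ y) = (e y).mapDomain (colMap σ))
    (hsupp : ∀ y q, e y q ≠ 0 → q.2 < kb y) (y : Y) {J : Fin (kb y) → ℕ} (hJ : J.Injective) :
    ∃ σ : Equiv.Perm ℕ, e (act σ y) = ∑ l : Fin (kb y), colWeight (e y) l (J l) := by
  obtain ⟨σ, hσ⟩ := exists_perm_extending hJ
  refine ⟨σ, ?_⟩
  rw [he, mapDomain_eq_sum_colWeight _ (hsupp y)]
  simp only [hσ]

theorem mapDomain_mem_closure_range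
    (he : ∀ (σ : Equiv.Perm ℕ) y, e (act σ y) = (e y).mapDomain (colMap σ))
    (hsupp : ∀ y q, e y q ≠ 0 → q.2 < kb y) {π : ℕ → ℕ} (hπ : StrictMono π)
    {a : Fin k × ℕ →₀ ℕ} (ha : a ∈ AddSubmonoid.closure (Set.range e)) :
    a.mapDomain (colMap π) ∈ AddSubmonoid.closure (Set.range e) := by
  induction ha using AddSubmonoid.closure_induction with
  | mem a ha =>
    obtain ⟨y, rfl⟩ := ha
    obtain ⟨σ, hσ⟩ := exists_act_eq_mapDomain he hsupp y
      (J := fun l => π l) (hπ.injective.comp Fin.val_injective)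
    rw [mapDomain_eq_sum_colWeight _ (hsupp y), ← hσ]
    exact AddSubmonoid.subset_closure ⟨_, rfl⟩
  | zero => simp
  | add a b _ _ ha hb =>
    rw [Finsupp.mapDomain_add]
    exact add_mem ha hb

theorem matrixExp_mem_closure_range
    (he : ∀ (σ : Equiv.Perm ℕ) y, e (act σ y) = (e y).mapDomain (colMap σ))
    (hsupp : ∀ y q, e y q ≠ 0 → q.2 < kb y) (y : Y) {B : Fin (kb y) → ℕ →₀ ℕ} {d : ℕ}
    (hB : IsMatchingSum B d) :
    matrixExp (e y) (kb y) B ∈ AddSubmonoid.closure (Set.range e) := by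
  have hle : AddSubmonoid.closure {G : Fin (kb y) → ℕ →₀ ℕ |
      ∃ J : Fin (kb y) → ℕ, J.Injective ∧ G = fun l => Finsupp.single (J l) 1} ≤
      (AddSubmonoid.closure (Set.range e)).comap (matrixExp (e y) (kb y)) := by
    rw [AddSubmonoid.closure_le]
    rintro _ ⟨J, hJ, rfl⟩
    obtain ⟨σ, hσ⟩ := exists_act_eq_mapDomain he hsupp y hJ
    rw [SetLike.mem_coe, AddSubmonoid.mem_comap, matrixExp_single, ← hσ]
    exact AddSubmonoid.subset_closure ⟨_, rfl⟩
  exact hle hB.mem_closure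

theorem exists_matrixExp_of_mem_closure {reps : Finset Y}
    (hreps : ∀ y : Y, ∃ y₀ ∈ reps, ∃ σ : Equiv.Perm ℕ, act σ y₀ = y)
    (he : ∀ (σ : Equiv.Perm ℕ) y, e (act σ y) = (e y).mapDomain (colMap σ))
    (hsupp : ∀ y q, e y q ≠ 0 → q.2 < kb y)
    {a : Fin k × ℕ →₀ ℕ} (ha : a ∈ AddSubmonoid.closure (Set.range e)) :
    ∃ (B : ∀ p : reps, Fin (kb p) → ℕ →₀ ℕ) (d : reps → ℕ), (∀ p, IsMatchingSum (B p) (d p)) ∧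
      a = ∑ p : reps, matrixExp (e p) (kb p) (B p) := by
  classical
  induction ha using AddSubmonoid.closure_induction with
  | mem a ha =>
    obtain ⟨y, rfl⟩ := ha
    obtain ⟨y₀, hy₀, σ, rfl⟩ := hreps y
    refine ⟨Pi.single ⟨y₀, hy₀⟩ fun l => Finsupp.single (σ l) 1, Pi.single ⟨y₀, hy₀⟩ 1,
      fun p => ?_, ?_⟩
    · by_cases hp : p = ⟨y₀, hy₀⟩
      · subst hp
        simpa using IsMatchingSum.of_injective (σ.injective.comp Fin.val_injective)
      · simpa [hp] using IsMatchingSum.zero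
    · rw [Finset.sum_eq_single ⟨y₀, hy₀⟩ (fun p _ hp => by simp [hp]) (by simp),
        Pi.single_eq_same, matrixExp_single _ fun l : Fin (kb y₀) => σ l, he,
        mapDomain_eq_sum_colWeight _ (hsupp y₀)]
  | zero => exact ⟨0, 0, fun p => IsMatchingSum.zero, by simp⟩
  | add a b _ _ ha hb =>
    obtain ⟨A, d, hA, rfl⟩ := ha
    obtain ⟨B, d', hB, rfl⟩ := hb
    exact ⟨A + B, d + d', fun p => (hA p).add (hB p), by simp [Finset.sum_add_distrib]⟩

theorem wellQuasiOrdered_closure_range {reps : Finset Y}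
    (hreps : ∀ y : Y, ∃ y₀ ∈ reps, ∃ σ : Equiv.Perm ℕ, act σ y₀ = y)
    (he : ∀ (σ : Equiv.Perm ℕ) y, e (act σ y) = (e y).mapDomain (colMap σ))
    (hsupp : ∀ y q, e y q ≠ 0 → q.2 < kb y) :
    WellQuasiOrdered fun a b : AddSubmonoid.closure (Set.range e) =>
      ∃ π : ℕ → ℕ, StrictMono π ∧ ∃ c ∈ AddSubmonoid.closure (Set.range e),
        (b : Fin k × ℕ →₀ ℕ) = (a : Fin k × ℕ →₀ ℕ).mapDomain (colMap π) + c := by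
  intro s
  choose B d hB hs using fun n => exists_matrixExp_of_mem_closure hreps he hsupp (s n).2
  obtain ⟨m, n, hmn, π, hπ, C, d', hC, h⟩ := exists_lt_eq_mapDomain_add B d hB
  refine ⟨m, n, hmn, π, hπ, ∑ p : reps, matrixExp (e p) (kb p) (C p),
    sum_mem fun p _ => matrixExp_mem_closure_range he hsupp p (hC p), ?_⟩
  rw [hs n, hs m, Finsupp.mapDomain_finsetSum, ← Finset.sum_add_distrib]
  refine Finset.sum_congr rfl fun p _ => ?_
  rw [← matrixExp_mapDomain, ← map_add]
  exact congrArg _ (funext fun l => h p l)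

theorem mem_range_iff_of_monomial {R : Type} [CommRing R]
    {φ : MvPolynomial Y R →ₐ[R] MvPolynomial (Fin k × ℕ) R}
    (hφ : ∀ y, φ (X y) = monomial (e y) 1) (f : MvPolynomial (Fin k × ℕ) R) :
    f ∈ φ.range ↔ ∀ b, coeff b f ≠ 0 → b ∈ AddSubmonoid.closure (Set.range e) := by
  classical
  constructor
  · rintro ⟨p, rfl⟩
    change ∀ b, coeff b (φ p) ≠ 0 → _
    induction p using MvPolynomial.induction_on with
    | C r =>
      intro b hb
      rw [← algebraMap_eq, φ.commutes, algebraMap_eq, coeff_C] at hb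
      exact (ite_ne_right_iff.1 hb).1 ▸ zero_mem _
    | add p q hp hq =>
      intro b hb
      by_cases h : coeff b (φ p) = 0
      · exact hq b fun h' => hb (by simp [h, h'])
      · exact hp b h
    | mul_X p y hp =>
      intro b hb
      rw [map_mul, hφ, coeff_mul_monomial', mul_one] at hb
      obtain ⟨hle, hb⟩ := ite_ne_right_iff.1 hb
      rw [← tsub_add_cancel_of_le hle]
      exact add_mem (hp _ hb) (AddSubmonoid.subset_closure ⟨y, rfl⟩)
  · intro hf
    have hmon : ∀ b ∈ AddSubmonoid.closure (Set.range e), monomial b (1 : R) ∈ φ.range := by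
      intro b hb
      induction hb using AddSubmonoid.closure_induction with
      | mem b hb =>
        obtain ⟨y, rfl⟩ := hb
        exact ⟨X y, hφ y⟩
      | zero => exact one_mem _
      | add a b _ _ ha hb =>
        have := mul_mem ha hb
        rwa [monomial_mul, one_mul] at this
    rw [← support_sum_monomial_coeff f]
    refine sum_mem fun b hb => ?_
    have := φ.range.smul_mem (hmon b (hf b (mem_support_iff.1 hb))) (coeff b f)
    rwa [smul_monomial, smul_eq_mul, mul_one] at this

end Image

/-- Main Theorem, image part.  With `Y`, the `Sym(ℕ)`-action `act` (each `y` fixed by all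
permutations fixing `[kb y]` pointwise, finitely many orbits with representatives `reps`)
and a `Sym(ℕ)`-equivariant monomial map `φ : R[Y] → R[X]` as in the Main Theorem, the image
of `φ` is stable under the `Inc(ℕ)`-action on `R[X]`, and `im φ` is `Inc(ℕ)`-Noetherian:
every `Inc(ℕ)`-stable ideal of `im φ` is generated by the union of finitely many
`Inc(ℕ)`-orbits of its elements. -/
theorem mainTheorem_image
    {R : Type} [CommRing R] [IsNoetherianRing R] (k : ℕ) {Y : Type}
    (act : Equiv.Perm ℕ → Y → Y)
    (act_one : ∀ y, act 1 y = y)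
    (act_mul : ∀ σ τ y, act (σ * τ) y = act σ (act τ y))
    (kb : Y → ℕ)
    (hkb : ∀ (y : Y) (σ : Equiv.Perm ℕ), (∀ i < kb y, σ i = i) → act σ y = y)
    (reps : Finset Y)
    (hreps : ∀ y : Y, ∃ y₀ ∈ reps, ∃ σ : Equiv.Perm ℕ, act σ y₀ = y)
    (φ : MvPolynomial Y R →ₐ[R] MvPolynomial (Fin k × ℕ) R)
    (hequiv : ∀ (σ : Equiv.Perm ℕ) (f : MvPolynomial Y R),
      φ (rename (act σ) f) = rename (fun q : Fin k × ℕ => (q.1, σ q.2)) (φ f))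
    (hmono : ∀ y : Y, ∃ m : Fin k × ℕ →₀ ℕ, φ (X y) = monomial m 1) :
    (∀ (π : ℕ → ℕ), StrictMono π → ∀ f ∈ φ.range,
        rename (fun q : Fin k × ℕ => (q.1, π q.2)) f ∈ φ.range) ∧
    ∀ I : Ideal φ.range,
      (∀ (π : ℕ → ℕ), StrictMono π → ∀ x ∈ I, ∀ y : φ.range,
          (y : MvPolynomial (Fin k × ℕ) R) =
            rename (fun q : Fin k × ℕ => (q.1, π q.2))
              (x : MvPolynomial (Fin k × ℕ) R) → y ∈ I) →
      ∃ F : Finset φ.range, (↑F : Set φ.range) ⊆ (I : Set φ.range) ∧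
        I = Ideal.span {g : φ.range | ∃ f ∈ F, ∃ π : ℕ → ℕ, StrictMono π ∧
          (g : MvPolynomial (Fin k × ℕ) R) =
            rename (fun q : Fin k × ℕ => (q.1, π q.2))
              (f : MvPolynomial (Fin k × ℕ) R)} := by
  rcases subsingleton_or_nontrivial R with hR | hR
  · refine ⟨fun π _ f _ => ?_, fun I _ => ⟨∅, by simp, Subsingleton.elim _ _⟩⟩
    rw [Subsingleton.elim (rename (fun q : Fin k × ℕ => (q.1, π q.2)) f) 0]
    exact zero_mem _
  choose e hφ using hmono
  have he : ∀ (σ : Equiv.Perm ℕ) y, e (act σ y) = (e y).mapDomain (colMap σ) := by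
    intro σ y
    have h := hequiv σ (X y)
    rw [rename_X, hφ, hφ, rename_monomial] at h
    exact monomial_left_injective one_ne_zero h
  have hsupp := lt_of_apply_ne_zero hkb he
  have hA := mem_range_iff_of_monomial hφ
  have hM : ∀ π : ℕ → ℕ, StrictMono π → ∀ a ∈ AddSubmonoid.closure (Set.range e),
      a.mapDomain (colMap π) ∈ AddSubmonoid.closure (Set.range e) :=
    fun π hπ a ha => mapDomain_mem_closure_range he hsupp hπ ha
  refine ⟨fun π hπ f hf => (hA _).2 fun b hb => ?_, fun I hI =>
    exists_finset_span_of_wellQuasiOrdered _ hA hM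
      (wellQuasiOrdered_closure_range hreps he hsupp) I hI⟩
  obtain ⟨u, rfl, hu⟩ := coeff_rename_ne_zero _ _ _ hb
  exact hM π hπ u ((hA f).1 hf u hu)
end
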